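/- arXiv:1306.2410 — 2 statements merged into one kernel-verified Lean document; each statement's English description precedes it below -/
import Mathlib

section
/- Let m ≥ n and n₁,…,n_m ≤ n be positive integers with N = n₁+⋯+n_m. For each 1 ≤ i ≤ m, let Uᵢ be an nᵢ×n real matrix with UᵢUᵢ* = I_{nᵢ}, let U be the N×n matrix with block rows U₁,…,U_m, and let D = diag(d₁I_{n₁},…,d_mI_{n_m}) with nonzero real entries dᵢ. If UU* ≥ D⁻¹ (i.e. UU* − D⁻¹ is positive semidefinite), then for all nonnegative Lebesgue measurable functions fᵢ on ℝ^{nᵢ}, ∫_{ℝⁿ} ∏_{i=1}^m fᵢ(Uᵢx) dγₙ(x) ≥ ∏_{i=1}^m (∫_{ℝ^{nᵢ}} fᵢ(xᵢ)^{1/dᵢ} dγ_{nᵢ}(xᵢ))^{dᵢ}. -/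
open MeasureTheory ProbabilityTheory Matrix
open scoped ENNReal

/-- The standard Gaussian measure on `ι → ℝ`. -/
noncomputable def stdGaussian (ι : Type*) [Fintype ι] : Measure (ι → ℝ) :=
  Measure.pi fun _ => gaussianReal 0 1

/-- Quadratic expansion of the logarithm with a cubic error term on a bounded region. -/
lemma aux_log_expand (c B : ℝ) (hc : 0 < c) (hB : 0 ≤ B) :
    ∃ K : ℝ, 0 ≤ K ∧ ∀ t : ℝ, c ≤ 1 + t → |t| ≤ B →
      |Real.log (1 + t) - (t - t ^ 2 / 2)| ≤ K * |t| ^ 3 := by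
  refine ⟨2 + 8 * (1 / c + B + B + B ^ 2 / 2), by positivity, fun t ht htB => ?_⟩
  have hK : 0 ≤ 8 * (1 / c + B + B + B ^ 2 / 2) := by positivity
  have ht3 : 0 ≤ |t| ^ 3 := by positivity
  by_cases h : |t| ≤ 1 / 2
  · have h1 := Real.abs_log_sub_add_sum_range_le (x := -t) (by rw [abs_neg]; linarith) 2
    simp only [Finset.sum_range_succ, Finset.sum_range_zero, abs_neg, sub_neg_eq_add] at h1
    have e1 : Real.log (1 + t) - (t - t ^ 2 / 2) =
      (0 + (-t) ^ (0 + 1) / ((0 : ℕ) + 1 : ℝ) + (-t) ^ (1 + 1) / ((1 : ℕ) + 1 : ℝ))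
        + Real.log (1 + t) := by
      push_cast; ring
    rw [e1]
    refine h1.trans ?_
    have : |t| ^ (2 + 1) / (1 - |t|) ≤ 2 * |t| ^ 3 := by
      rw [div_le_iff₀ (by linarith)]
      have := mul_nonneg ht3 (sub_nonneg.2 h)
      have e3 : |t| ^ (2 + 1) = |t| ^ 3 := rfl
      rw [e3]; linarith
    linarith [mul_nonneg hK ht3]
  · push Not at h
    have hp : 0 < 1 + t := lt_of_lt_of_le hc ht
    have l1 : Real.log (1 + t) ≤ t := by
      have := Real.log_le_sub_one_of_pos hp; linarith
    have l2 : -(1 / c) ≤ Real.log (1 + t) := by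
      have h2 := Real.one_sub_inv_le_log_of_pos hp
      have : (1 + t)⁻¹ ≤ 1 / c := by
        rw [one_div]; exact inv_anti₀ hc ht
      linarith
    have hb := abs_le.1 htB
    have ht2 : t ^ 2 ≤ B ^ 2 := by
      rw [← sq_abs t]; exact pow_le_pow_left₀ (abs_nonneg _) htB 2
    have hsq := sq_nonneg t
    have hc' : 0 < 1 / c := by positivity
    have h8 : 1 ≤ 8 * |t| ^ 3 := by
      have : (1 / 2 : ℝ) ^ 3 ≤ |t| ^ 3 := pow_le_pow_left₀ (by norm_num) h.le 3
      norm_num at this ⊢; linarith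
    have hS : 0 ≤ 1 / c + B + B + B ^ 2 / 2 := by positivity
    have : |Real.log (1 + t) - (t - t ^ 2 / 2)| ≤ 1 / c + B + B + B ^ 2 / 2 := by
      rw [abs_le]; constructor <;> nlinarith
    nlinarith

lemma aux_exp_lower (z : ℝ) : 1 + z + z ^ 2 / 2 - |z| ^ 3 ≤ Real.exp z := by
  by_cases hz : 0 ≤ z
  · have := Real.quadratic_le_exp_of_nonneg hz
    have h3 : 0 ≤ |z| ^ 3 := by positivity
    linarith
  · push Not at hz
    have hn : |z| = -z := abs_of_neg hz
    rw [hn]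
    by_cases h1 : z ≤ -1
    · have := Real.add_one_le_exp z
      nlinarith [sq_nonneg z]
    · push Not at h1
      have h := Real.exp_bound (x := z) (by rw [hn]; linarith) (n := 3) (by norm_num)
      simp [Finset.sum_range_succ, Nat.factorial] at h
      rw [hn] at h
      have h2 := (abs_le.1 h).1
      have : 0 ≤ (-z) ^ 3 := pow_nonneg (by linarith) 3
      nlinarith

/-- Quadratic lower expansion of `∏ (1 + t i) ^ d i`. -/
lemma aux_prod_expand {ι : Type*} [Fintype ι] (d : ι → ℝ) (c B : ℝ) (hc : 0 < c) (hB : 0 ≤ B) :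
    ∃ K : ℝ, 0 ≤ K ∧ ∀ (t : ι → ℝ) (s : ℝ), (∀ i, c ≤ 1 + t i) → (∀ i, |t i| ≤ B) →
      (∀ i, |t i| ≤ s) →
      1 + ∑ i, d i * t i + ((∑ i, d i * t i) ^ 2 - ∑ i, d i * t i ^ 2) / 2 - K * s ^ 3
        ≤ ∏ i, (1 + t i) ^ d i := by
  obtain ⟨K₀, hK₀, hlog⟩ := aux_log_expand c B hc hB
  set S := ∑ i, |d i| with hS
  have hS0 : 0 ≤ S := Finset.sum_nonneg fun _ _ => abs_nonneg _
  -- constants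
  set Z := S + S * B / 2 + S * K₀ * B ^ 2 with hZ
  set Y := S / 2 + S * K₀ * B with hY
  have hZ0 : 0 ≤ Z := by positivity
  have hY0 : 0 ≤ Y := by positivity
  refine ⟨S * K₀ + Y * (Z + S) / 2 + Z ^ 3, by positivity, fun t s h1 h2 h3 => ?_⟩
  rcases isEmpty_or_nonempty ι with he | ⟨⟨i₀⟩⟩
  · have hS' : S = 0 := by simp [hS]
    simp [hS', hZ, hY]
  have hs0' : 0 ≤ s := (abs_nonneg _).trans (h3 i₀)
  -- reduce to `s ≤ B`
  wlog hsB : s ≤ B generalizing s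
  · push Not at hsB
    have := this B h2 hB le_rfl
    have hp : B ^ 3 ≤ s ^ 3 := pow_le_pow_left₀ hB hsB.le 3
    have hK : 0 ≤ S * K₀ + Y * (Z + S) / 2 + Z ^ 3 := by positivity
    nlinarith
  set p := ∑ i, d i * t i with hp
  set q := ∑ i, d i * t i ^ 2 with hq
  set z := ∑ i, d i * Real.log (1 + t i) with hz
  have hprod : ∏ i, (1 + t i) ^ d i = Real.exp z := by
    rw [hz, Real.exp_sum]
    refine Finset.prod_congr rfl fun i _ => ?_
    rw [Real.rpow_def_of_pos (lt_of_lt_of_le hc (h1 i)), mul_comm]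
  have hpb : |p| ≤ S * s := by
    rw [hp, hS, Finset.sum_mul]
    refine (Finset.abs_sum_le_sum_abs _ _).trans (Finset.sum_le_sum fun i _ => ?_)
    rw [abs_mul]; exact mul_le_mul_of_nonneg_left (h3 i) (abs_nonneg _)
  have hqb : |q| ≤ S * s ^ 2 := by
    rw [hq, hS, Finset.sum_mul]
    refine (Finset.abs_sum_le_sum_abs _ _).trans (Finset.sum_le_sum fun i _ => ?_)
    rw [abs_mul, abs_pow]
    exact mul_le_mul_of_nonneg_left (pow_le_pow_left₀ (abs_nonneg _) (h3 i) 2) (abs_nonneg _)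
  have heb : |z - (p - q / 2)| ≤ S * K₀ * s ^ 3 := by
    have : z - (p - q / 2) = ∑ i, d i * (Real.log (1 + t i) - (t i - t i ^ 2 / 2)) := by
      simp only [hz, hp, hq, mul_sub, Finset.sum_sub_distrib, Finset.sum_div, mul_div_assoc]
    rw [this, hS, Finset.sum_mul, Finset.sum_mul]
    refine (Finset.abs_sum_le_sum_abs _ _).trans (Finset.sum_le_sum fun i _ => ?_)
    rw [abs_mul, mul_assoc]
    refine mul_le_mul_of_nonneg_left ((hlog _ (h1 i) (h2 i)).trans ?_) (abs_nonneg _)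
    exact mul_le_mul_of_nonneg_left (pow_le_pow_left₀ (abs_nonneg _) (h3 i) 3) hK₀
  have hzp : |z - p| ≤ Y * s ^ 2 := by
    have h4 : |z - p| ≤ |z - (p - q / 2)| + |q| / 2 := by
      have : z - p = (z - (p - q / 2)) + (-(q / 2)) := by ring
      rw [this]
      refine (abs_add_le _ _).trans ?_
      rw [abs_neg, abs_div, abs_two]
    have h5 : S * K₀ * s ^ 3 ≤ S * K₀ * B * s ^ 2 := by
      have : s ^ 3 ≤ B * s ^ 2 := by nlinarith [sq_nonneg s]
      have := mul_le_mul_of_nonneg_left this (mul_nonneg hS0 hK₀)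
      linarith
    rw [hY]; nlinarith
  have hzb : |z| ≤ Z * s := by
    have h4 : |z| ≤ |z - p| + |p| := by
      have : z = (z - p) + p := by ring
      calc |z| = |(z - p) + p| := by rw [← this]
        _ ≤ _ := abs_add_le _ _
    have h5 : Y * s ^ 2 ≤ Y * B * s := by
      have : s ^ 2 ≤ B * s := by nlinarith
      have := mul_le_mul_of_nonneg_left this hY0
      linarith
    have h6 : Z * s = S * s + Y * B * s := by rw [hZ, hY]; ring
    linarith
  have hz2 : |z ^ 2 - p ^ 2| ≤ Y * (Z + S) * s ^ 3 := by
    have : z ^ 2 - p ^ 2 = (z - p) * (z + p) := by ring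
    rw [this, abs_mul]
    have h4 : |z + p| ≤ (Z + S) * s := (abs_add_le _ _).trans (by linarith)
    calc _ ≤ (Y * s ^ 2) * ((Z + S) * s) := mul_le_mul hzp h4 (abs_nonneg _) (by positivity)
      _ = _ := by ring
  have hz3 : |z| ^ 3 ≤ Z ^ 3 * s ^ 3 := by
    rw [← mul_pow]; exact pow_le_pow_left₀ (abs_nonneg _) hzb 3
  rw [hprod]
  have h6 := aux_exp_lower z
  have h7 := (abs_le.1 heb).1
  have h8 := (abs_le.1 hz2).1
  nlinarith

/-- Functions with values in `[c, C]` with a first order expansion whose differential lies in `V`. -/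
structure AuxCls {E : Type*} [NormedAddCommGroup E] [NormedSpace ℝ E] [MeasurableSpace E]
    (V : Submodule ℝ (E →L[ℝ] ℝ)) (c C L : ℝ) (G : E → ℝ) (A : E → E →L[ℝ] ℝ) : Prop where
  meas : Measurable G
  smeas : StronglyMeasurable A
  lo : ∀ x, c ≤ G x
  hi : ∀ x, G x ≤ C
  mem : ∀ x, A x ∈ V
  bd : ∀ x, ‖A x‖ ≤ L
  taylor : ∀ x y, |G (x + y) - G x - A x y| ≤ L * ‖y‖ ^ 2

lemma aux_rpow_le {c C g : ℝ} (hc : 0 < c) (h1 : c ≤ g) (h2 : g ≤ C) (d : ℝ) :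
    g ^ d ≤ c ^ d + C ^ d := by
  have hg : 0 < g := lt_of_lt_of_le hc h1
  have hC : 0 < C := lt_of_lt_of_le hg h2
  rcases le_total 0 d with h | h
  · have := Real.rpow_le_rpow hg.le h2 h
    have := Real.rpow_nonneg hc.le d
    linarith
  · have := Real.rpow_le_rpow_of_nonpos hc h1 h
    have := Real.rpow_nonneg hC.le d
    linarith

/-- Algebraic comparison of quadratic expressions. -/
lemma aux_quad {ι : Type*} [Fintype ι] (d l t e : ι → ℝ) (S K h w : ℝ) (hS : S = ∑ i, |d i|)
    (hh : 0 < h) (hh1 : h ≤ 1) (hK : 0 ≤ K) (hw : 1 ≤ w)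
    (hl : ∀ i, |l i| ≤ K * w) (ht : ∀ i, |t i| ≤ K * h ^ 2 * w) (he : ∀ i, e i = h * l i + t i) :
    h ^ 2 * ((∑ i, d i * l i) ^ 2 - ∑ i, d i * l i ^ 2)
      - 3 * K ^ 2 * (S ^ 2 + S) * h ^ 3 * w ^ 3 ≤ (∑ i, d i * e i) ^ 2 - ∑ i, d i * e i ^ 2 := by
  have hS0 : 0 ≤ S := hS ▸ Finset.sum_nonneg fun _ _ => abs_nonneg _
  have hw0 : 0 ≤ w := by linarith
  set P := ∑ i, d i * l i with hP
  set T := ∑ i, d i * t i with hT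
  have e1 : ∑ i, d i * e i = h * P + T := by
    rw [hP, hT, Finset.mul_sum, ← Finset.sum_add_distrib]
    refine Finset.sum_congr rfl fun i _ => ?_
    rw [he]; ring
  have e2 : ∑ i, d i * e i ^ 2 = h ^ 2 * ∑ i, d i * l i ^ 2
      + ∑ i, d i * (t i * (2 * h * l i + t i)) := by
    rw [Finset.mul_sum, ← Finset.sum_add_distrib]
    refine Finset.sum_congr rfl fun i _ => ?_
    rw [he]; ring
  have hPb : |P| ≤ S * (K * w) := by
    rw [hP, hS, Finset.sum_mul]
    refine (Finset.abs_sum_le_sum_abs _ _).trans (Finset.sum_le_sum fun i _ => ?_)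
    rw [abs_mul]; exact mul_le_mul_of_nonneg_left (hl i) (abs_nonneg _)
  have hTb : |T| ≤ S * (K * h ^ 2 * w) := by
    rw [hT, hS, Finset.sum_mul]
    refine (Finset.abs_sum_le_sum_abs _ _).trans (Finset.sum_le_sum fun i _ => ?_)
    rw [abs_mul]; exact mul_le_mul_of_nonneg_left (ht i) (abs_nonneg _)
  have hhh : h ^ 2 ≤ h := by nlinarith
  have hww : w ^ 2 ≤ w ^ 3 := by nlinarith [sq_nonneg w]
  have key : ∀ a b R : ℝ, 0 ≤ R → |a| ≤ R * (K * w) → |b| ≤ R * (K * h ^ 2 * w) →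
      |b * (2 * h * a + b)| ≤ 3 * K ^ 2 * R ^ 2 * h ^ 3 * w ^ 3 := by
    intro a b R hR ha hb
    rw [abs_mul]
    have h1 : |2 * h * a + b| ≤ 3 * R * K * h * w := by
      refine (abs_add_le _ _).trans ?_
      rw [abs_mul, abs_of_pos (by positivity : 0 < 2 * h)]
      have h2 : 2 * h * |a| ≤ 2 * h * (R * (K * w)) :=
        mul_le_mul_of_nonneg_left ha (by positivity)
      have h3 : R * (K * h ^ 2 * w) ≤ R * (K * h * w) := by gcongr
      linarith
    calc |b| * |2 * h * a + b| ≤ (R * (K * h ^ 2 * w)) * (3 * R * K * h * w) :=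
          mul_le_mul hb h1 (abs_nonneg _) (by positivity)
      _ = 3 * K ^ 2 * R ^ 2 * h ^ 3 * w ^ 2 := by ring
      _ ≤ _ := mul_le_mul_of_nonneg_left hww (by positivity)
  have k1 := key P T S hS0 hPb hTb
  have k2 : |∑ i, d i * (t i * (2 * h * l i + t i))| ≤ S * (3 * K ^ 2 * h ^ 3 * w ^ 3) := by
    rw [hS, Finset.sum_mul]
    refine (Finset.abs_sum_le_sum_abs _ _).trans (Finset.sum_le_sum fun i _ => ?_)
    rw [abs_mul]
    refine mul_le_mul_of_nonneg_left ?_ (abs_nonneg _)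
    have := key (l i) (t i) 1 zero_le_one (by simpa using hl i) (by simpa using ht i)
    simpa using this
  rw [e1, e2]
  have k1' := (abs_le.1 k1).1
  have k2' := (abs_le.1 k2).2
  nlinarith

section
variable {E : Type*} [NormedAddCommGroup E] [NormedSpace ℝ E] [MeasurableSpace E] [BorelSpace E]
  [FiniteDimensional ℝ E] {ι : Type*} [Fintype ι]

lemma AuxCls.integrable {V : Submodule ℝ (E →L[ℝ] ℝ)} {c C L : ℝ} (hc : 0 < c)
    {G : E → ℝ} {A : E → E →L[ℝ] ℝ}
    (hG : AuxCls V c C L G A) (μ : Measure E) [IsProbabilityMeasure μ] (x : E) (h : ℝ) :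
    Integrable (fun y => G (x + h • y)) μ := by
  refine Integrable.of_bound (C := C) ?_ ?_
  · exact (hG.meas.comp (by fun_prop : Measurable fun y : E => x + h • y)).aestronglyMeasurable
  · refine Filter.Eventually.of_forall fun y => ?_
    rw [Real.norm_of_nonneg (hc.le.trans (hG.lo _))]; exact hG.hi _

lemma AuxCls.integral_lo {V : Submodule ℝ (E →L[ℝ] ℝ)} {c C L : ℝ} (hc : 0 < c)
    {G : E → ℝ} {A : E → E →L[ℝ] ℝ}
    (hG : AuxCls V c C L G A) (μ : Measure E) [IsProbabilityMeasure μ] (x : E) (h : ℝ) :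
    c ≤ ∫ y, G (x + h • y) ∂μ := by
  have := integral_mono (integrable_const c) (hG.integrable hc μ x h) (fun y => hG.lo _)
  simpa using this

lemma AuxCls.integral_hi {V : Submodule ℝ (E →L[ℝ] ℝ)} {c C L : ℝ} (hc : 0 < c)
    {G : E → ℝ} {A : E → E →L[ℝ] ℝ}
    (hG : AuxCls V c C L G A) (μ : Measure E) [IsProbabilityMeasure μ] (x : E) (h : ℝ) :
    ∫ y, G (x + h • y) ∂μ ≤ C := by
  have := integral_mono (hG.integrable hc μ x h) (integrable_const C) (fun y => hG.hi _)
  simpa using this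

lemma aux_integrable_prod {V : ι → Submodule ℝ (E →L[ℝ] ℝ)} {c C L : ℝ} (hc : 0 < c)
    {G : ι → E → ℝ} {A : ι → E → E →L[ℝ] ℝ} (d : ι → ℝ)
    (hG : ∀ i, AuxCls (V i) c C L (G i) (A i)) (μ : Measure E) [IsProbabilityMeasure μ] (x : E)
    (h : ℝ) :
    Integrable (fun y => ∏ i, G i (x + h • y) ^ d i) μ := by
  refine Integrable.of_bound (C := ∏ i, (c ^ d i + C ^ d i)) ?_ ?_
  · refine Measurable.aestronglyMeasurable ?_
    refine Finset.measurable_prod _ fun i _ => ?_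
    have := (hG i).meas.comp (by fun_prop : Measurable fun y : E => x + h • y)
    exact this.pow_const _
  · refine Filter.Eventually.of_forall fun y => ?_
    rw [Real.norm_of_nonneg]
    · exact Finset.prod_le_prod (fun i _ => Real.rpow_nonneg (hc.le.trans ((hG i).lo _)) _)
        fun i _ => aux_rpow_le hc ((hG i).lo _) ((hG i).hi _) _
    · exact Finset.prod_nonneg fun i _ => Real.rpow_nonneg (hc.le.trans ((hG i).lo _)) _

/-- The one-step inequality. -/
lemma aux_one_step (μ : Measure E) [IsProbabilityMeasure μ]
    (hmean : ∀ l : E →L[ℝ] ℝ, ∫ y, l y ∂μ = 0)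
    (hmom : ∀ p : ℕ, Integrable (fun y => ‖y‖ ^ p) μ)
    (d : ι → ℝ) (V : ι → Submodule ℝ (E →L[ℝ] ℝ))
    (hV : ∀ l : ι → E →L[ℝ] ℝ, (∀ i, l i ∈ V i) →
      ∑ i, d i * ∫ y, (l i y) ^ 2 ∂μ ≤ ∫ y, (∑ i, d i * l i y) ^ 2 ∂μ)
    (c C L : ℝ) (hc : 0 < c) (hcC : c ≤ C) (hL : 0 ≤ L) :
    ∃ K : ℝ, 0 ≤ K ∧ ∀ (h : ℝ), 0 < h → h ≤ 1 → ∀ (G : ι → E → ℝ) (A : ι → E → E →L[ℝ] ℝ),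
      (∀ i, AuxCls (V i) c C L (G i) (A i)) → ∀ x,
      (1 - K * h ^ 3) * ∏ i, (∫ y, G i (x + h • y) ∂μ) ^ d i
        ≤ ∫ y, ∏ i, G i (x + h • y) ^ d i ∂μ := by
  have hC : 0 < C := lt_of_lt_of_le hc hcC
  obtain ⟨K₀, hK₀, hexp⟩ := aux_prod_expand d (c / C) (C / c) (by positivity) (by positivity)
  set M := ∫ y, ‖y‖ ^ 2 ∂μ with hM
  have hM0 : 0 ≤ M := integral_nonneg fun y => by positivity
  set w : E → ℝ := fun y => 1 + ‖y‖ ^ 2 + M with hw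
  have hw1 : ∀ y, 1 ≤ w y := fun y => by
    have : 0 ≤ ‖y‖ ^ 2 := by positivity
    simp only [hw]; linarith
  have hw3 : Integrable (fun y => w y ^ 3) μ := by
    have e : (fun y => w y ^ 3) = fun y => (1 + M) ^ 3 + 3 * (1 + M) ^ 2 * ‖y‖ ^ 2
        + 3 * (1 + M) * ‖y‖ ^ 4 + ‖y‖ ^ 6 := by
      funext y; simp only [hw]; ring
    rw [e]
    exact (((integrable_const _).add ((hmom 2).const_mul _)).add ((hmom 4).const_mul _)).add
      (hmom 6)
  set W := ∫ y, w y ^ 3 ∂μ with hW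
  have hW0 : 0 ≤ W := integral_nonneg fun y => pow_nonneg (zero_le_one.trans (hw1 y)) 3
  set S := ∑ i, |d i| with hS
  have hS0 : 0 ≤ S := Finset.sum_nonneg fun _ _ => abs_nonneg _
  set K₁ := L / c with hK₁
  have hK₁0 : 0 ≤ K₁ := by positivity
  set K₂ := K₀ * (2 * K₁) ^ 3 + 3 * K₁ ^ 2 * (S ^ 2 + S) / 2 with hK₂
  refine ⟨K₂ * W, by positivity, fun h hh hh1 G A hG x => ?_⟩
  set g : ι → ℝ := fun i => ∫ y, G i (x + h • y) ∂μ with hg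
  have hglo : ∀ i, c ≤ g i := fun i => (hG i).integral_lo hc μ x h
  have hghi : ∀ i, g i ≤ C := fun i => (hG i).integral_hi hc μ x h
  have hg0 : ∀ i, 0 < g i := fun i => lt_of_lt_of_le hc (hglo i)
  set l : ι → E →L[ℝ] ℝ := fun i => (g i)⁻¹ • A i x with hl
  have hlV : ∀ i, l i ∈ V i := fun i => (V i).smul_mem _ ((hG i).mem x)
  set e : ι → E → ℝ := fun i y => (G i (x + h • y) - g i) / g i with he
  set t : ι → E → ℝ := fun i y => e i y - h * l i y with ht
  have hlin : ∀ l : E →L[ℝ] ℝ, Integrable (fun y => l y) μ := fun l => by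
    refine ((hmom 1).const_mul ‖l‖).mono' l.continuous.aestronglyMeasurable ?_
    exact Filter.Eventually.of_forall fun y => by simpa using l.le_opNorm y
  have hlin2 : ∀ l : E →L[ℝ] ℝ, Integrable (fun y => l y ^ 2) μ := fun l => by
    refine ((hmom 2).const_mul (‖l‖ ^ 2)).mono' (l.continuous.pow 2).aestronglyMeasurable ?_
    exact Filter.Eventually.of_forall fun y => by
      rw [norm_pow, ← mul_pow]; exact pow_le_pow_left₀ (norm_nonneg _) (l.le_opNorm y) 2
  -- pointwise bounds
  have hty : ∀ i y, |G i (x + h • y) - G i x - h * A i x y| ≤ L * h ^ 2 * ‖y‖ ^ 2 := fun i y => by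
    have := (hG i).taylor x (h • y)
    rw [map_smul, smul_eq_mul, norm_smul, Real.norm_of_nonneg hh.le] at this
    calc _ ≤ _ := this
      _ = _ := by ring
  have hgb : ∀ i, |g i - G i x| ≤ L * h ^ 2 * M := fun i => by
    have e1 : g i - G i x = ∫ y, (G i (x + h • y) - G i x - h * A i x y) ∂μ := by
      rw [integral_sub, integral_sub, integral_const_mul, hmean]
      · simp [hg]
      · exact (hG i).integrable hc μ x h
      · exact integrable_const _
      · exact ((hG i).integrable hc μ x h).sub (integrable_const _)
      · exact (hlin _).const_mul _
    rw [e1]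
    refine (abs_integral_le_integral_abs).trans ?_
    rw [hM, ← integral_const_mul]
    refine integral_mono_of_nonneg (Filter.Eventually.of_forall fun y => abs_nonneg _)
      ((hmom 2).const_mul _) (Filter.Eventually.of_forall fun y => hty i y)
  have hyw : ∀ y, ‖y‖ ≤ w y := fun y => by
    simp only [hw]; nlinarith [sq_nonneg (‖y‖ - 1)]
  have htb : ∀ i y, |t i y| ≤ K₁ * h ^ 2 * w y := fun i y => by
    have e1 : t i y = ((G i (x + h • y) - G i x - h * A i x y) - (g i - G i x)) / g i := by
      simp only [ht, he, hl, ContinuousLinearMap.smul_apply, smul_eq_mul]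
      have := (hg0 i).ne'
      field_simp
      ring
    rw [e1, abs_div, abs_of_pos (hg0 i)]
    have h1 := (abs_sub (G i (x + h • y) - G i x - h * A i x y) (g i - G i x)).trans
      (add_le_add (hty i y) (hgb i))
    have h2 : L * h ^ 2 * ‖y‖ ^ 2 + L * h ^ 2 * M ≤ L * h ^ 2 * w y := by
      simp only [hw]; nlinarith [mul_nonneg hL (sq_nonneg h)]
    have h0 : 0 ≤ L * h ^ 2 * w y := by
      have := zero_le_one.trans (hw1 y); positivity
    calc _ ≤ (L * h ^ 2 * w y) / g i := div_le_div_of_nonneg_right (h1.trans h2) (hg0 i).le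
      _ ≤ (L * h ^ 2 * w y) / c := div_le_div_of_nonneg_left h0 hc (hglo i)
      _ = _ := by rw [hK₁]; ring
  have hlb : ∀ i y, |l i y| ≤ K₁ * w y := fun i y => by
    simp only [hl, ContinuousLinearMap.smul_apply, smul_eq_mul]
    rw [abs_mul, abs_inv, abs_of_pos (hg0 i)]
    have h1 : |A i x y| ≤ L * w y :=
      ((A i x).le_opNorm y).trans (mul_le_mul ((hG i).bd x) (hyw y) (norm_nonneg _) hL)
    have h2 : (g i)⁻¹ ≤ c⁻¹ := inv_anti₀ hc (hglo i)
    calc _ ≤ c⁻¹ * (L * w y) := mul_le_mul h2 h1 (abs_nonneg _) (by positivity)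
      _ = _ := by rw [hK₁]; ring
  have hee : ∀ i y, e i y = h * l i y + t i y := fun i y => by simp [ht]
  have heb : ∀ i y, |e i y| ≤ 2 * K₁ * h * w y := fun i y => by
    rw [hee]
    refine (abs_add_le _ _).trans ?_
    rw [abs_mul, abs_of_pos hh]
    have h1 := mul_le_mul_of_nonneg_left (hlb i y) hh.le
    have h2 := htb i y
    have h3 : K₁ * h ^ 2 * w y ≤ K₁ * h * w y := by
      have := zero_le_one.trans (hw1 y)
      have : h ^ 2 ≤ h := by nlinarith
      gcongr
    linarith
  have h1e : ∀ i y, 1 + e i y = G i (x + h • y) / g i := fun i y => by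
    simp only [he]; have := (hg0 i).ne'; field_simp; ring
  have h1eb : ∀ i y, c / C ≤ 1 + e i y := fun i y => by
    rw [h1e]
    exact div_le_div₀ (hc.le.trans ((hG i).lo _)) ((hG i).lo _) (hg0 i) (hghi i)
  have heB : ∀ i y, |e i y| ≤ C / c := fun i y => by
    have h1 : 1 + e i y ≤ C / c := by
      rw [h1e]; exact div_le_div₀ hC.le ((hG i).hi _) hc (hglo i)
    have h2 : 1 ≤ C / c := by rw [le_div_iff₀ hc]; linarith
    have h3 : 0 < c / C := by positivity
    have h4 := h1eb i y
    rw [abs_le]; constructor <;> linarith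
  -- pointwise inequality
  have hpt : ∀ y, 1 + ∑ i, d i * e i y
      + h ^ 2 / 2 * ((∑ i, d i * l i y) ^ 2 - ∑ i, d i * (l i y) ^ 2) - K₂ * h ^ 3 * w y ^ 3
      ≤ ∏ i, (1 + e i y) ^ d i := fun y => by
    have h1 := hexp (fun i => e i y) (2 * K₁ * h * w y) (fun i => h1eb i y) (fun i => heB i y)
      (fun i => heb i y)
    have h2 := aux_quad d (fun i => l i y) (fun i => t i y) (fun i => e i y) S K₁ h (w y) hS hh
      hh1 hK₁0 (hw1 y) (fun i => hlb i y) (fun i => htb i y) (fun i => hee i y)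
    refine le_trans ?_ h1
    have e3 : K₂ * h ^ 3 * w y ^ 3 = K₀ * (2 * K₁ * h * w y) ^ 3
      + (3 * K₁ ^ 2 * (S ^ 2 + S) * h ^ 3 * w y ^ 3) / 2 := by rw [hK₂]; ring
    rw [e3]
    linarith
  -- integrate
  have hei : ∀ i, Integrable (e i) μ := fun i =>
    (((hG i).integrable hc μ x h).sub (integrable_const _)).div_const _
  have he0 : ∀ i, ∫ y, e i y ∂μ = 0 := fun i => by
    simp only [he]
    rw [integral_div, integral_sub ((hG i).integrable hc μ x h) (integrable_const _)]
    simp [hg]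
  have hsum : Integrable (fun y => (∑ i, d i * l i y) ^ 2) μ := by
    have := hlin2 (∑ i, d i • l i)
    simpa [ContinuousLinearMap.sum_apply] using this
  have hsum2 : Integrable (fun y => ∑ i, d i * (l i y) ^ 2) μ :=
    integrable_finsetSum _ fun i _ => (hlin2 (l i)).const_mul _
  have hsum1 : Integrable (fun y => ∑ i, d i * e i y) μ :=
    integrable_finsetSum _ fun i _ => (hei i).const_mul _
  have hprodeq : ∀ y, ∏ i, G i (x + h • y) ^ d i
      = (∏ i, g i ^ d i) * ∏ i, (1 + e i y) ^ d i := fun y => by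
    rw [← Finset.prod_mul_distrib]
    refine Finset.prod_congr rfl fun i _ => ?_
    rw [h1e, Real.div_rpow (hc.le.trans ((hG i).lo _)) (hg0 i).le,
      mul_div_cancel₀ _ (Real.rpow_pos_of_pos (hg0 i) _).ne']
  have hgp : 0 < ∏ i, g i ^ d i := Finset.prod_pos fun i _ => Real.rpow_pos_of_pos (hg0 i) _
  have hintp : Integrable (fun y => ∏ i, (1 + e i y) ^ d i) μ := by
    have h1 := (aux_integrable_prod hc d hG μ x h).const_mul (∏ i, g i ^ d i)⁻¹
    refine h1.congr (Filter.Eventually.of_forall fun y => ?_)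
    simp only [hprodeq]
    rw [inv_mul_cancel_left₀ hgp.ne']
  simp_rw [hprodeq]
  rw [integral_const_mul, mul_comm]
  refine mul_le_mul_of_nonneg_left ?_ hgp.le
  have hint := integral_mono (((((integrable_const (1 : ℝ)).add hsum1).add
    ((hsum.sub hsum2).const_mul (h ^ 2 / 2))).sub (hw3.const_mul (K₂ * h ^ 3)))) hintp hpt
  refine le_trans ?_ hint
  simp only [Pi.add_apply, Pi.sub_apply]
  rw [integral_sub, integral_add, integral_add, integral_const_mul, integral_const_mul,
    integral_sub hsum hsum2, integral_finsetSum, integral_finsetSum]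
  · simp_rw [integral_const_mul, he0]
    have h2 := hV l hlV
    have h3 : 0 ≤ h ^ 2 / 2 := by positivity
    have h4 := mul_nonneg h3 (sub_nonneg.2 h2)
    simp only [integral_const, probReal_univ, smul_eq_mul, mul_zero, Finset.sum_const_zero]
    rw [← hW]
    linarith
  · exact fun i _ => (hlin2 (l i)).const_mul _
  · exact fun i _ => (hei i).const_mul _
  · exact integrable_const _
  · exact hsum1
  · exact (integrable_const _).add hsum1
  · exact (hsum.sub hsum2).const_mul _
  · exact ((integrable_const _).add hsum1).add ((hsum.sub hsum2).const_mul _)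
  · exact hw3.const_mul _

end

section
variable {E : Type*} [NormedAddCommGroup E] [InnerProductSpace ℝ E] [MeasurableSpace E]
  [BorelSpace E] [FiniteDimensional ℝ E] {ι : Type*} [Fintype ι]

lemma aux_gauss_conv (a b : ℝ) :
    ((ProbabilityTheory.stdGaussian E).map (a • ·)) ∗ ((ProbabilityTheory.stdGaussian E).map (b • ·))
      = (ProbabilityTheory.stdGaussian E).map (√(a ^ 2 + b ^ 2) • ·) := by
  have : ∀ r : ℝ, IsProbabilityMeasure ((ProbabilityTheory.stdGaussian E).map (r • ·)) := fun r =>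
    Measure.isProbabilityMeasure_map (by fun_prop)
  refine Measure.ext_of_charFun ?_
  funext t
  rw [charFun_conv]
  simp only [charFun_map_smul, charFun_stdGaussian, ← Complex.exp_add, norm_smul]
  congr 1
  norm_cast
  rw [mul_pow, mul_pow, mul_pow]
  simp only [Real.norm_eq_abs, sq_abs]
  rw [Real.sq_sqrt (by positivity)]
  ring

lemma aux_gauss_iter (Φ : E → ℝ) (hΦ : Measurable Φ) (B : ℝ) (hB : ∀ x, |Φ x| ≤ B) (a b : ℝ)
    (x : E) :
    ∫ y, ∫ z, Φ (x + a • y + b • z) ∂(ProbabilityTheory.stdGaussian E)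
      ∂(ProbabilityTheory.stdGaussian E)
      = ∫ y, Φ (x + √(a ^ 2 + b ^ 2) • y) ∂(ProbabilityTheory.stdGaussian E) := by
  have : ∀ r : ℝ, IsProbabilityMeasure ((ProbabilityTheory.stdGaussian E).map (r • ·)) := fun r =>
    Measure.isProbabilityMeasure_map (by fun_prop)
  have hm : Measurable fun y => Φ (x + y) := hΦ.comp (by fun_prop)
  have e1 : ∫ y, Φ (x + √(a ^ 2 + b ^ 2) • y) ∂(ProbabilityTheory.stdGaussian E)
      = ∫ y, Φ (x + y) ∂((ProbabilityTheory.stdGaussian E).map (√(a ^ 2 + b ^ 2) • ·)) := by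
    rw [integral_map (by fun_prop) hm.aestronglyMeasurable]
  rw [e1, ← aux_gauss_conv, integral_conv, integral_map (by fun_prop)]
  · refine integral_congr_ae (Filter.Eventually.of_forall fun y => ?_)
    simp only
    rw [integral_map (by fun_prop)]
    · simp only [add_assoc]
    · exact (hm.comp (by fun_prop : Measurable fun z => a • y + z)).aestronglyMeasurable
  · have : StronglyMeasurable fun p : E × E => Φ (x + (p.1 + p.2)) :=
      (hm.comp (by fun_prop : Measurable fun p : E × E => p.1 + p.2)).stronglyMeasurable
    exact this.integral_prod_right.aestronglyMeasurable
  · exact Integrable.of_bound hm.aestronglyMeasurable B (Filter.Eventually.of_forall fun y => hB _)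

lemma AuxCls.avg {V : Submodule ℝ (E →L[ℝ] ℝ)} {c C L : ℝ} (hc : 0 < c)
    {G : E → ℝ} {A : E → E →L[ℝ] ℝ}
    (hG : AuxCls V c C L G A) (μ : Measure E) [IsProbabilityMeasure μ] (h : ℝ) :
    AuxCls V c C L (fun x => ∫ y, G (x + h • y) ∂μ) (fun x => ∫ y, A (x + h • y) ∂μ) := by
  have hAi : ∀ x, Integrable (fun y => A (x + h • y)) μ := fun x => by
    refine Integrable.of_bound (C := L) ?_ (Filter.Eventually.of_forall fun y => hG.bd _)
    exact (hG.smeas.comp_measurable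
      (by fun_prop : Measurable fun y : E => x + h • y)).aestronglyMeasurable
  refine ⟨?_, ?_, fun x => hG.integral_lo hc μ x h, fun x => hG.integral_hi hc μ x h, fun x => ?_,
    fun x => ?_, fun x y => ?_⟩
  · have : StronglyMeasurable fun p : E × E => G (p.1 + h • p.2) :=
      (hG.meas.comp (by fun_prop : Measurable fun p : E × E => p.1 + h • p.2)).stronglyMeasurable
    exact this.integral_prod_right.measurable
  · have : StronglyMeasurable fun p : E × E => A (p.1 + h • p.2) :=
      (hG.smeas.comp_measurable (by fun_prop : Measurable fun p : E × E => p.1 + h • p.2))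
    exact this.integral_prod_right
  · exact Convex.integral_mem V.convex V.closed_of_finiteDimensional
      (Filter.Eventually.of_forall fun y => hG.mem _) (hAi x)
  · have := norm_integral_le_of_norm_le_const (μ := μ) (C := L)
      (Filter.Eventually.of_forall fun y => hG.bd (x + h • y))
    simpa using this
  · rw [ContinuousLinearMap.integral_apply (hAi x) y,
      ← integral_sub (hG.integrable hc μ _ h) (hG.integrable hc μ _ h),
      ← integral_sub (f := fun a => G (x + y + h • a) - G (x + h • a))
        ((hG.integrable hc μ _ h).sub (hG.integrable hc μ _ h))
        ((hAi x).apply_continuousLinearMap y)]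
    rw [← Real.norm_eq_abs]
    refine (norm_integral_le_of_norm_le_const (μ := μ) (C := L * ‖y‖ ^ 2)
      (Filter.Eventually.of_forall fun z => ?_)).trans (by simp)
    have := hG.taylor (x + h • z) y
    rw [add_right_comm] at this
    exact this

lemma aux_prod_meas_bd {V : ι → Submodule ℝ (E →L[ℝ] ℝ)} {c C L : ℝ} (hc : 0 < c)
    {G : ι → E → ℝ} {A : ι → E → E →L[ℝ] ℝ} (d : ι → ℝ)
    (hG : ∀ i, AuxCls (V i) c C L (G i) (A i)) :
    Measurable (fun y => ∏ i, G i y ^ d i) ∧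
      ∀ y, |∏ i, G i y ^ d i| ≤ ∏ i, (c ^ d i + C ^ d i) := by
  constructor
  · refine Finset.measurable_prod _ fun i _ => ?_
    exact (hG i).meas.pow_const _
  · intro y
    rw [abs_of_nonneg]
    · exact Finset.prod_le_prod (fun i _ => Real.rpow_nonneg (hc.le.trans ((hG i).lo _)) _)
        fun i _ => aux_rpow_le hc ((hG i).lo _) ((hG i).hi _) _
    · exact Finset.prod_nonneg fun i _ => Real.rpow_nonneg (hc.le.trans ((hG i).lo _)) _

lemma aux_iter {V : ι → Submodule ℝ (E →L[ℝ] ℝ)} {c C L : ℝ} (hc : 0 < c) (d : ι → ℝ)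
    (K h : ℝ) (hKh : K * h ^ 3 ≤ 1) (hh : 0 < h)
    (hstep : ∀ (G : ι → E → ℝ) (A : ι → E → E →L[ℝ] ℝ),
      (∀ i, AuxCls (V i) c C L (G i) (A i)) → ∀ x,
      (1 - K * h ^ 3) * ∏ i, (∫ y, G i (x + h • y) ∂(ProbabilityTheory.stdGaussian E)) ^ d i
        ≤ ∫ y, ∏ i, G i (x + h • y) ^ d i ∂(ProbabilityTheory.stdGaussian E))
    (k : ℕ) : ∀ (G : ι → E → ℝ) (A : ι → E → E →L[ℝ] ℝ),
      (∀ i, AuxCls (V i) c C L (G i) (A i)) → ∀ x,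
      (1 - K * h ^ 3) ^ k *
        ∏ i, (∫ y, G i (x + (h * √k) • y) ∂(ProbabilityTheory.stdGaussian E)) ^ d i
        ≤ ∫ y, ∏ i, G i (x + (h * √k) • y) ^ d i ∂(ProbabilityTheory.stdGaussian E) := by
  induction k with
  | zero => intro G A hG x; simp
  | succ k ih =>
    intro G A hG x
    set γ := ProbabilityTheory.stdGaussian E with hγ
    have hsq : h * √((k + 1 : ℕ) : ℝ) = √((h * √k) ^ 2 + h ^ 2) := by
      rw [mul_pow, Real.sq_sqrt (by positivity)]
      have : h ^ 2 * k + h ^ 2 = h ^ 2 * ((k + 1 : ℕ) : ℝ) := by push_cast; ring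
      rw [this, Real.sqrt_mul (by positivity), Real.sqrt_sq hh.le]
    have hG' := fun i => (hG i).avg hc γ h
    have h1 := ih _ _ hG' x
    obtain ⟨hm, hb⟩ := aux_prod_meas_bd hc d hG
    have h2 := aux_gauss_iter (fun y => ∏ i, G i y ^ d i) hm _ hb (h * √k) h x
    rw [hsq, ← h2]
    have e3 : ∀ i, ∫ y, G i (x + √((h * √k) ^ 2 + h ^ 2) • y) ∂γ
        = ∫ y, ∫ z, G i (x + (h * √k) • y + h • z) ∂γ ∂γ := fun i => by
      refine (aux_gauss_iter (G i) (hG i).meas C (fun y => ?_) (h * √k) h x).symm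
      rw [abs_of_nonneg (hc.le.trans ((hG i).lo _))]; exact (hG i).hi _
    simp_rw [e3]
    rw [pow_succ', mul_assoc]
    refine (mul_le_mul_of_nonneg_left h1 (by linarith)).trans ?_
    rw [← integral_const_mul]
    refine integral_mono ((aux_integrable_prod hc d hG' γ x _).const_mul _) ?_
      (fun y => hstep G A hG _)
    have : StronglyMeasurable fun p : E × E => ∏ i, G i (x + (h * √k) • p.1 + h • p.2) ^ d i :=
      (hm.comp (by fun_prop : Measurable fun p : E × E => x + (h * √k) • p.1 + h • p.2)).stronglyMeasurable
    refine Integrable.of_bound (C := ∏ i, (c ^ d i + C ^ d i))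
      this.integral_prod_right.aestronglyMeasurable (Filter.Eventually.of_forall fun y => ?_)
    refine (norm_integral_le_of_norm_le_const (μ := γ)
      (Filter.Eventually.of_forall fun z => hb _)).trans (by simp)

/-- The inequality for regular functions. -/
lemma aux_core (d : ι → ℝ) (V : ι → Submodule ℝ (E →L[ℝ] ℝ))
    (hV : ∀ l : ι → E →L[ℝ] ℝ, (∀ i, l i ∈ V i) →
      ∑ i, d i * ‖l i‖ ^ 2 ≤ ‖∑ i, d i • l i‖ ^ 2)
    (c C L : ℝ) (hc : 0 < c) (hcC : c ≤ C) (hL : 0 ≤ L)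
    (G : ι → E → ℝ) (A : ι → E → E →L[ℝ] ℝ) (hG : ∀ i, AuxCls (V i) c C L (G i) (A i)) :
    ∏ i, (∫ y, G i y ∂(ProbabilityTheory.stdGaussian E)) ^ d i
        ≤ ∫ y, ∏ i, G i y ^ d i ∂(ProbabilityTheory.stdGaussian E) := by
  set γ := ProbabilityTheory.stdGaussian E with hγ
  have hmean : ∀ l : E →L[ℝ] ℝ, ∫ y, l y ∂γ = 0 := fun l => integral_strongDual_stdGaussian l
  have hmom : ∀ p : ℕ, Integrable (fun y => ‖y‖ ^ p) γ := fun p => by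
    have := (IsGaussian.memLp_id γ p (by simp)).integrable_norm_pow'
    simpa using this
  have hvar : ∀ l : E →L[ℝ] ℝ, ∫ y, (l y) ^ 2 ∂γ = ‖l‖ ^ 2 := fun l => by
    have h1 := variance_dual_stdGaussian l
    rw [variance_eq_integral l.continuous.aemeasurable] at h1
    simpa [integral_strongDual_stdGaussian] using h1
  obtain ⟨K, hK, hstep⟩ := aux_one_step γ hmean hmom d V (fun l hl => by
    have := hV l hl
    simp_rw [hvar]
    rw [← hvar (∑ i, d i • l i)] at this
    simpa using this) c C L hc hcC hL
  have hP : 0 ≤ ∏ i, (∫ y, G i y ∂γ) ^ d i :=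
    Finset.prod_nonneg fun i _ => Real.rpow_nonneg
      (integral_nonneg fun y => hc.le.trans ((hG i).lo y)) _
  have hk : ∀ᶠ k : ℕ in Filter.atTop, (1 - K * (√k)⁻¹) * ∏ i, (∫ y, G i y ∂γ) ^ d i
      ≤ ∫ y, ∏ i, G i y ^ d i ∂γ := by
    have ht : Filter.Tendsto (fun k : ℕ => K * (√(k : ℝ))⁻¹) Filter.atTop (nhds (K * 0)) :=
      (Filter.Tendsto.inv_tendsto_atTop
        (Real.tendsto_sqrt_atTop.comp tendsto_natCast_atTop_atTop)).const_mul K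
    rw [mul_zero] at ht
    filter_upwards [ht.eventually_le_const (zero_lt_one), Filter.eventually_ge_atTop 1] with k h1 h2
    have hk1 : (1 : ℝ) ≤ k := by exact_mod_cast h2
    have hs1 : 1 ≤ √(k : ℝ) := by rw [Real.one_le_sqrt]; exact hk1
    have hs0 : 0 < √(k : ℝ) := by linarith
    set h := (√(k : ℝ))⁻¹ with hh
    have hh0 : 0 < h := by positivity
    have hh1 : h ≤ 1 := inv_le_one_of_one_le₀ hs1
    have hkh : (k : ℝ) * h ^ 2 = 1 := by
      rw [hh, inv_pow, Real.sq_sqrt (by positivity)]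
      field_simp
    have hKh : K * h ^ 3 ≤ 1 := by
      refine le_trans (mul_le_mul_of_nonneg_left ?_ hK) h1
      calc h ^ 3 = h * h ^ 2 := by ring
        _ ≤ h * 1 := mul_le_mul_of_nonneg_left (by nlinarith) hh0.le
        _ = h := mul_one h
    have h3 := aux_iter hc d K h hKh hh0 (hstep h hh0 hh1) k G A hG 0
    have hone : h * √(k : ℝ) = 1 := inv_mul_cancel₀ hs0.ne'
    rw [hone] at h3
    simp only [zero_add, one_smul] at h3
    refine le_trans (mul_le_mul_of_nonneg_right ?_ hP) h3
    have h4 := one_add_mul_le_pow (a := -(K * h ^ 3)) (by linarith) k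
    rw [← sub_eq_add_neg] at h4
    refine le_trans (le_of_eq ?_) h4
    have : (k : ℝ) * (K * h ^ 3) = K * h := by
      calc (k : ℝ) * (K * h ^ 3) = K * h * (k * h ^ 2) := by ring
        _ = K * h := by rw [hkh, mul_one]
    rw [mul_neg, this]; ring
  have ht : Filter.Tendsto (fun k : ℕ => (1 - K * (√(k : ℝ))⁻¹) * ∏ i, (∫ y, G i y ∂γ) ^ d i)
      Filter.atTop (nhds ((1 - K * 0) * ∏ i, (∫ y, G i y ∂γ) ^ d i)) :=
    (((Filter.Tendsto.inv_tendsto_atTop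
        (Real.tendsto_sqrt_atTop.comp tendsto_natCast_atTop_atTop)).const_mul K).const_sub
          1).mul_const _
  have := le_of_tendsto ht hk
  simpa using this

end

section
variable {E : Type*} [NormedAddCommGroup E] [InnerProductSpace ℝ E] [MeasurableSpace E]
  [BorelSpace E] [FiniteDimensional ℝ E]

lemma AuxCls.mono {V : Submodule ℝ (E →L[ℝ] ℝ)} {c C L c' C' L' : ℝ}
    {G : E → ℝ} {A : E → E →L[ℝ] ℝ} (hG : AuxCls V c C L G A) (h1 : c' ≤ c) (h2 : C ≤ C')
    (h3 : L ≤ L') : AuxCls V c' C' L' G A :=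
  ⟨hG.meas, hG.smeas, fun x => h1.trans (hG.lo x), fun x => (hG.hi x).trans h2, hG.mem,
    fun x => (hG.bd x).trans h3, fun x y => (hG.taylor x y).trans
      (mul_le_mul_of_nonneg_right h3 (by positivity))⟩

lemma AuxCls.pull {F : Type*} [NormedAddCommGroup F] [InnerProductSpace ℝ F] [MeasurableSpace F]
    [BorelSpace F] [FiniteDimensional ℝ F] {c C L : ℝ} (hL : 0 ≤ L)
    {G : F → ℝ} {A : F → F →L[ℝ] ℝ} (hG : AuxCls ⊤ c C L G A) (T : E →L[ℝ] F) :
    AuxCls (LinearMap.range ((ContinuousLinearMap.compL ℝ E F ℝ).flip T).toLinearMap) c C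
      (L * (‖T‖ + ‖T‖ ^ 2)) (fun x => G (T x)) (fun x => (A (T x)).comp T) := by
  refine ⟨hG.meas.comp (by fun_prop), ?_, fun x => hG.lo _, fun x => hG.hi _, fun x => ?_,
    fun x => ?_, fun x y => ?_⟩
  · have h1 : StronglyMeasurable fun x => A (T x) :=
      hG.smeas.comp_measurable (T.continuous.measurable)
    exact ((ContinuousLinearMap.compL ℝ E F ℝ).flip T).continuous.comp_stronglyMeasurable h1
  · exact ⟨A (T x), rfl⟩
  · refine (ContinuousLinearMap.opNorm_comp_le _ _).trans ?_
    have := mul_le_mul_of_nonneg_right (hG.bd (T x)) (norm_nonneg T)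
    nlinarith [mul_nonneg hL (sq_nonneg ‖T‖)]
  · rw [map_add]
    refine (hG.taylor (T x) (T y)).trans ?_
    have h1 : ‖T y‖ ^ 2 ≤ (‖T‖ * ‖y‖) ^ 2 := pow_le_pow_left₀ (norm_nonneg _) (T.le_opNorm y) 2
    have h2 : (‖T‖ * ‖y‖) ^ 2 ≤ (‖T‖ + ‖T‖ ^ 2) * ‖y‖ ^ 2 := by
      have := mul_nonneg (norm_nonneg T) (sq_nonneg ‖y‖)
      nlinarith
    rw [mul_assoc]
    exact mul_le_mul_of_nonneg_left (h1.trans h2) hL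

/-- Mollified functions are regular. -/
lemma aux_smooth (φ : ContDiffBump (0 : E)) (f : E → ℝ) (hf : Integrable f volume)
    (C : ℝ) (h0 : ∀ x, 0 ≤ f x) (hC : ∀ x, f x ≤ C) (c : ℝ) :
    ∃ L, 0 ≤ L ∧ ∃ A, AuxCls ⊤ c (c + C) L
      (fun x => c + convolution (φ.normed volume) f (ContinuousLinearMap.lsmul ℝ ℝ) volume x) A := by
  set ψ := φ.normed (volume : Measure E) with hψ
  have hψs : ContDiff ℝ 2 ψ := φ.contDiff_normed
  have hψc : HasCompactSupport ψ := φ.hasCompactSupport_normed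
  have hd : ContDiff ℝ 1 (fderiv ℝ ψ) := hψs.fderiv_right (by norm_num)
  have hdc : HasCompactSupport (fderiv ℝ ψ) := hψc.fderiv ℝ
  obtain ⟨L₀, hL₀⟩ := hd.lipschitzWith_of_hasCompactSupport hdc (by norm_num)
  obtain ⟨L₁, hL₁⟩ := hdc.exists_bound_of_continuous hd.continuous
  obtain ⟨L₂, hL₂⟩ := hψc.exists_bound_of_continuous hψs.continuous
  have hL₁0 : 0 ≤ L₁ := (norm_nonneg _).trans (hL₁ 0)
  have htay : ∀ x y, |ψ (x + y) - ψ x - fderiv ℝ ψ x y| ≤ L₀ * ‖y‖ ^ 2 := by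
    intro x y
    have h1 := (convex_segment x (x + y)).norm_image_sub_le_of_norm_hasFDerivWithin_le'
      (f := ψ) (f' := fderiv ℝ ψ) (φ := fderiv ℝ ψ x) (C := L₀ * ‖y‖)
      (fun z _ => (hψs.differentiable (by norm_num) z).hasFDerivAt.hasFDerivWithinAt)
      (fun z hz => by
        have h2 := hL₀.dist_le_mul z x
        rw [dist_eq_norm, dist_eq_norm] at h2
        refine h2.trans (mul_le_mul_of_nonneg_left ?_ L₀.coe_nonneg)
        rw [segment_eq_image'] at hz
        obtain ⟨θ, hθ, rfl⟩ := hz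
        simp only [add_sub_cancel_left, norm_smul]
        rw [Real.norm_of_nonneg hθ.1]
        exact mul_le_of_le_one_left (norm_nonneg _) hθ.2)
      (left_mem_segment ℝ x (x + y)) (right_mem_segment ℝ x (x + y))
    rw [add_sub_cancel_left] at h1
    calc _ ≤ _ := h1
      _ = _ := by ring
  have hconv : ∀ x, convolution ψ f (ContinuousLinearMap.lsmul ℝ ℝ) volume x
      = ∫ t, ψ (x - t) * f t := fun x => by
    rw [convolution_eq_swap]; rfl
  have hcont : ∀ x : E, Continuous fun t => x - t := fun x => by fun_prop
  have hi1 : ∀ x, Integrable (fun t => ψ (x - t) * f t) volume := fun x =>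
    hf.bdd_mul (c := L₂) (hψs.continuous.comp (hcont x)).aestronglyMeasurable
      (Filter.Eventually.of_forall fun t => hL₂ _)
  have hi2 : ∀ x, Integrable (fun t => f t • fderiv ℝ ψ (x - t)) volume := fun x =>
    (hf.norm.const_mul L₁).mono'
      (hf.aestronglyMeasurable.smul (hd.continuous.comp (hcont x)).aestronglyMeasurable)
      (Filter.Eventually.of_forall fun t => by
        rw [norm_smul, mul_comm]
        exact mul_le_mul_of_nonneg_right (hL₁ _) (norm_nonneg _))
  set J := ∫ t, f t with hJ
  have hJ0 : 0 ≤ J := integral_nonneg h0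
  have hmass : ∀ x, ∫ t, ψ (x - t) = 1 := fun x => by
    rw [integral_sub_left_eq_self ψ volume x]; exact φ.integral_normed
  have hmi : ∀ x, Integrable (fun t => ψ (x - t)) volume := fun x =>
    (integrable_comp_sub_left ψ x).2 φ.integrable_normed
  refine ⟨(L₀ + L₁) * J, by positivity, fun x => ∫ t, f t • fderiv ℝ ψ (x - t), ?_, ?_, ?_, ?_, ?_,
    ?_, ?_⟩
  · simp_rw [hconv]
    have hm : AEStronglyMeasurable f volume := hf.aestronglyMeasurable
    have : Continuous (convolution f ψ (ContinuousLinearMap.lsmul ℝ ℝ) volume) :=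
      hψc.continuous_convolution_right _ hf.locallyIntegrable hψs.continuous
    have e : (fun x => ∫ t, ψ (x - t) * f t) = convolution f ψ (ContinuousLinearMap.lsmul ℝ ℝ) volume := by
      funext x; simp only [convolution, ContinuousLinearMap.lsmul_apply, smul_eq_mul, mul_comm]
    rw [← e] at this
    exact measurable_const.add this.measurable
  · have : Continuous (convolution f (fderiv ℝ ψ) (ContinuousLinearMap.lsmul ℝ ℝ) volume) :=
      hdc.continuous_convolution_right _ hf.locallyIntegrable hd.continuous
    exact this.stronglyMeasurable
  · intro x
    rw [hconv]
    have : 0 ≤ ∫ t, ψ (x - t) * f t :=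
      integral_nonneg fun t => mul_nonneg (φ.nonneg_normed _) (h0 t)
    linarith
  · intro x
    rw [hconv]
    have : ∫ t, ψ (x - t) * f t ≤ ∫ t, ψ (x - t) * C :=
      integral_mono (hi1 x) ((hmi x).mul_const C)
        fun t => mul_le_mul_of_nonneg_left (hC t) (φ.nonneg_normed _)
    rw [integral_mul_const, hmass] at this
    linarith
  · intro x; trivial
  · intro x
    have h1 : ‖∫ t, f t • fderiv ℝ ψ (x - t)‖ ≤ ∫ t, L₁ * f t :=
      norm_integral_le_of_norm_le (hf.const_mul L₁) (Filter.Eventually.of_forall fun t => by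
        rw [norm_smul, Real.norm_of_nonneg (h0 t), mul_comm]
        exact mul_le_mul_of_nonneg_right (hL₁ _) (h0 t))
    rw [integral_const_mul] at h1
    nlinarith [mul_nonneg L₀.coe_nonneg hJ0]
  · intro x y
    rw [hconv, hconv, ContinuousLinearMap.integral_apply (hi2 x) y]
    have e1 : c + (∫ t, ψ (x + y - t) * f t) - (c + ∫ t, ψ (x - t) * f t)
        = (∫ t, ψ (x + y - t) * f t) - ∫ t, ψ (x - t) * f t := by ring
    rw [e1, ← integral_sub (hi1 _) (hi1 _),
      ← integral_sub (f := fun t => ψ (x + y - t) * f t - ψ (x - t) * f t)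
        ((hi1 _).sub (hi1 _)) ((hi2 x).apply_continuousLinearMap y), ← Real.norm_eq_abs]
    have h1 : ‖∫ t, (ψ (x + y - t) * f t - ψ (x - t) * f t - (f t • fderiv ℝ ψ (x - t)) y)‖
        ≤ ∫ t, (L₀ * ‖y‖ ^ 2) * f t :=
      norm_integral_le_of_norm_le (hf.const_mul _) (Filter.Eventually.of_forall fun t => by
        have h2 := htay (x - t) y
        have e2 : ψ (x + y - t) * f t - ψ (x - t) * f t - (f t • fderiv ℝ ψ (x - t)) y
          = (ψ (x - t + y) - ψ (x - t) - fderiv ℝ ψ (x - t) y) * f t := by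
          rw [_root_.smul_apply, smul_eq_mul, sub_add_eq_add_sub]; ring
        rw [e2, norm_mul, Real.norm_of_nonneg (h0 t)]
        exact mul_le_mul_of_nonneg_right h2 (h0 t))
    rw [integral_const_mul] at h1
    refine h1.trans ?_
    have := mul_nonneg (mul_nonneg hL₁0 hJ0) (sq_nonneg ‖y‖)
    nlinarith

lemma aux_gauss_ac : ProbabilityTheory.stdGaussian E ≪ (volume : Measure E) := by
  set g : E → ℝ := fun v => Real.exp (-(1 / 2) * ‖v‖ ^ 2) with hg
  set Z : ℝ := (Real.pi / (1 / 2)) ^ (Module.finrank ℝ E / 2 : ℝ) with hZ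
  have hZ0 : 0 < Z := by positivity
  have hgi : Integrable g volume := by
    have := GaussianFourier.integrable_cexp_neg_mul_sq_norm_add (V := E) (b := (1 / 2 : ℂ)) (by norm_num) 0 0
    have h2 := this.norm
    refine h2.congr (Filter.Eventually.of_forall fun v => ?_)
    simp only [hg, Complex.norm_exp]
    norm_num
    norm_cast
  have hgc : Continuous g := by fun_prop
  set ρ : E → ℝ≥0∞ := fun v => ENNReal.ofReal (Z⁻¹ * g v) with hρ
  have hfin : IsFiniteMeasure ((volume : Measure E).withDensity ρ) :=
    isFiniteMeasure_withDensity_ofReal (hgi.const_mul _).2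
  have : ProbabilityTheory.stdGaussian E = (volume : Measure E).withDensity ρ := by
    refine Measure.ext_of_charFun ?_
    funext t
    rw [charFun_stdGaussian, charFun_apply]
    rw [integral_withDensity_eq_integral_toReal_smul (by fun_prop) (by simp [hρ])]
    have h1 := GaussianFourier.integral_cexp_neg_mul_sq_norm_add (V := E) (b := (1 / 2 : ℂ)) (by norm_num)
      Complex.I t
    have h2 : ∀ v : E, (ρ v).toReal • Complex.exp ((inner ℝ v t : ℝ) * Complex.I)
        = (Z : ℂ)⁻¹ * Complex.exp (-(1 / 2 : ℂ) * ‖v‖ ^ 2 + Complex.I * (inner ℝ t v : ℝ)) := by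
      intro v
      rw [hρ, ENNReal.toReal_ofReal (by positivity), Complex.exp_add, Complex.real_smul,
        real_inner_comm]
      push_cast [hg]
      rw [mul_comm Complex.I]
      ring
    simp_rw [h2]
    rw [integral_const_mul, h1]
    have h3 : ((Real.pi : ℂ) / (1 / 2)) ^ (Module.finrank ℝ E / 2 : ℂ) = (Z : ℂ) := by
      rw [hZ, Complex.ofReal_cpow (by positivity)]
      push_cast
      rfl
    rw [h3, inv_mul_cancel_left₀ (by exact_mod_cast hZ0.ne')]
    congr 1
    rw [Complex.I_sq]; ring
  rw [this]
  exact withDensity_absolutelyContinuous _ _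
end

section
variable {E : Type*} [NormedAddCommGroup E] [InnerProductSpace ℝ E] [MeasurableSpace E]
  [BorelSpace E] [FiniteDimensional ℝ E] {ι : Type*} [Fintype ι] {F : ι → Type*}
  [∀ i, NormedAddCommGroup (F i)] [∀ i, InnerProductSpace ℝ (F i)] [∀ i, MeasurableSpace (F i)]
  [∀ i, BorelSpace (F i)] [∀ i, FiniteDimensional ℝ (F i)]

/-- The inequality in question, for extended nonnegative functions. -/
def AuxP (d : ι → ℝ) (T : ∀ i, E →L[ℝ] F i) (H : ∀ i, F i → ℝ≥0∞) : Prop :=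
  ∏ i, (∫⁻ z, H i z ∂(ProbabilityTheory.stdGaussian (F i))) ^ d i
    ≤ ∫⁻ x, ∏ i, H i (T i x) ^ d i ∂(ProbabilityTheory.stdGaussian E)

lemma aux_limit {d : ι → ℝ} {T : ∀ i, E →L[ℝ] F i}
    (hT : ∀ i, (ProbabilityTheory.stdGaussian E).map (T i) = ProbabilityTheory.stdGaussian (F i))
    {Hk : ℕ → ∀ i, F i → ℝ≥0∞} {H : ∀ i, F i → ℝ≥0∞}
    (hP : ∀ k, AuxP d T (Hk k)) (hm : ∀ k i, Measurable (Hk k i))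
    (hae : ∀ i, ∀ᵐ z ∂(ProbabilityTheory.stdGaussian (F i)),
      Filter.Tendsto (fun k => Hk k i z) Filter.atTop (nhds (H i z)))
    (hint : ∀ i, Filter.Tendsto (fun k => ∫⁻ z, Hk k i z ∂(ProbabilityTheory.stdGaussian (F i)))
      Filter.atTop (nhds (∫⁻ z, H i z ∂(ProbabilityTheory.stdGaussian (F i)))))
    (B : ι → ℝ≥0∞) (hB : ∀ i, B i ≠ ∞) (hbd : ∀ k i z, Hk k i z ^ d i ≤ B i)
    (hfin : ∀ i, (∫⁻ z, H i z ∂(ProbabilityTheory.stdGaussian (F i))) ^ d i ≠ ∞) :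
    AuxP d T H := by
  have h1 : Filter.Tendsto
      (fun k => ∏ i, (∫⁻ z, Hk k i z ∂(ProbabilityTheory.stdGaussian (F i))) ^ d i)
      Filter.atTop (nhds (∏ i, (∫⁻ z, H i z ∂(ProbabilityTheory.stdGaussian (F i))) ^ d i)) :=
    ENNReal.tendsto_finsetProd_of_ne_top _
      (fun i _ => (ENNReal.continuous_rpow_const.tendsto _).comp (hint i)) (fun i _ => hfin i)
  have hBp : ∏ i, B i ≠ ∞ := ENNReal.prod_ne_top fun i _ => hB i
  have h2 : Filter.Tendsto
      (fun k => ∫⁻ x, ∏ i, Hk k i (T i x) ^ d i ∂(ProbabilityTheory.stdGaussian E))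
      Filter.atTop (nhds (∫⁻ x, ∏ i, H i (T i x) ^ d i ∂(ProbabilityTheory.stdGaussian E))) := by
    refine MeasureTheory.tendsto_lintegral_of_dominated_convergence (fun _ => ∏ i, B i) ?_ ?_ ?_ ?_
    · intro k
      exact Finset.measurable_prod _ fun i _ =>
        ((hm k i).comp (T i).continuous.measurable).pow_const _
    · intro k
      exact Filter.Eventually.of_forall fun x =>
        Finset.prod_le_prod' fun i _ => hbd k i (T i x)
    · simpa using hBp
    · have h3 : ∀ᵐ x ∂(ProbabilityTheory.stdGaussian E), ∀ i,
          Filter.Tendsto (fun k => Hk k i (T i x)) Filter.atTop (nhds (H i (T i x))) := by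
        rw [ae_all_iff]
        intro i
        have := hae i
        rw [← hT i] at this
        exact ae_of_ae_map (T i).continuous.measurable.aemeasurable this
      filter_upwards [h3] with x hx
      have h4 : ∀ i, Filter.Tendsto (fun k => Hk k i (T i x) ^ d i) Filter.atTop
          (nhds (H i (T i x) ^ d i)) :=
        fun i => (ENNReal.continuous_rpow_const.tendsto _).comp (hx i)
      refine ENNReal.tendsto_finsetProd_of_ne_top _ (fun i _ => h4 i) (fun i _ => ?_)
      exact ne_top_of_le_ne_top (hB i)
        (le_of_tendsto (h4 i) (Filter.Eventually.of_forall fun k => hbd k i _))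
  exact le_of_tendsto_of_tendsto h1 h2 (Filter.Eventually.of_forall hP)

lemma aux_rpow_anti {a b : ℝ≥0∞} {d : ℝ} (hd : d ≤ 0) (h : a ≤ b) : b ^ d ≤ a ^ d := by
  obtain ⟨e, rfl⟩ : ∃ e, d = -e := ⟨-d, by simp⟩
  rw [ENNReal.rpow_neg, ENNReal.rpow_neg, ENNReal.inv_le_inv]
  exact ENNReal.rpow_le_rpow h (by linarith)

lemma aux_ofReal_rpow_bd {a b x d : ℝ} (ha : 0 < a) (h1 : a ≤ x) (h2 : x ≤ b) :
    ENNReal.ofReal x ^ d ≤ ENNReal.ofReal a ^ d + ENNReal.ofReal b ^ d := by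
  rcases le_total 0 d with hd | hd
  · exact (ENNReal.rpow_le_rpow (ENNReal.ofReal_le_ofReal h2) hd).trans le_add_self
  · refine le_trans ?_ le_self_add
    exact aux_rpow_anti hd (ENNReal.ofReal_le_ofReal h1)

lemma aux_ofReal_rpow_fin {a d : ℝ} (ha : 0 < a) : ENNReal.ofReal a ^ d ≠ ∞ := by
  rw [ENNReal.ofReal_rpow_of_pos ha]; exact ENNReal.ofReal_ne_top

lemma aux_stepA {d : ι → ℝ} {T : ∀ i, E →L[ℝ] F i}
    (hT : ∀ i, (ProbabilityTheory.stdGaussian E).map (T i) = ProbabilityTheory.stdGaussian (F i))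
    (hq : ∀ l : ∀ i, F i →L[ℝ] ℝ, ∑ i, d i * ‖(l i).comp (T i)‖ ^ 2
      ≤ ‖∑ i, d i • (l i).comp (T i)‖ ^ 2)
    (c C : ι → ℝ) (hc : ∀ i, 0 < c i) (f : ∀ i, F i → ℝ)
    (hf : ∀ i, Integrable (f i) volume) (h0 : ∀ i x, 0 ≤ f i x) (hC : ∀ i x, f i x ≤ C i) :
    AuxP d T (fun i z => ENNReal.ofReal (c i + f i z)) := by
  have hC0 : ∀ i, 0 ≤ C i := fun i => (h0 i 0).trans (hC i 0)
  let φ : ∀ i, ℕ → ContDiffBump (0 : F i) := fun i k =>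
    ⟨1 / ((k : ℝ) + 1), 2 / ((k : ℝ) + 1), by positivity, by gcongr; norm_num⟩
  let G : ℕ → ∀ i, F i → ℝ := fun k i x => c i + convolution ((φ i k).normed volume) (f i)
    (ContinuousLinearMap.lsmul ℝ ℝ) volume x
  have hG : ∀ k i, ∃ L, 0 ≤ L ∧ ∃ A, AuxCls ⊤ (c i) (c i + C i) L (G k i) A :=
    fun k i => aux_smooth (φ i k) (f i) (hf i) (C i) (h0 i) (hC i) (c i)
  choose L hL A hA using hG
  have hlim : ∀ i, ∀ᵐ z ∂(ProbabilityTheory.stdGaussian (F i)),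
      Filter.Tendsto (fun k => ENNReal.ofReal (G k i z)) Filter.atTop
        (nhds (ENNReal.ofReal (c i + f i z))) := by
    intro i
    have t0 : Filter.Tendsto (fun k : ℕ => 2 / ((k : ℝ) + 1)) Filter.atTop (nhds 0) := by
      have := (tendsto_one_div_add_atTop_nhds_zero_nat (𝕜 := ℝ)).const_mul 2
      simpa [div_eq_mul_inv] using this
    have h1 := ContDiffBump.ae_convolution_tendsto_right_of_locallyIntegrable (μ := volume)
      (φ := φ i) (l := Filter.atTop) (K := 2) (g := f i) t0
      (Filter.Eventually.of_forall fun k => by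
        show 2 / ((k : ℝ) + 1) ≤ 2 * (1 / ((k : ℝ) + 1))
        rw [mul_one_div])
      (hf i).locallyIntegrable
    filter_upwards [aux_gauss_ac.ae_le h1] with z hz
    exact ENNReal.tendsto_ofReal (hz.const_add (c i))
  refine aux_limit hT (Hk := fun k i z => ENNReal.ofReal (G k i z)) ?_ ?_ hlim ?_
    (fun i => ENNReal.ofReal (c i) ^ d i + ENNReal.ofReal (c i + C i) ^ d i) ?_ ?_ ?_
  · intro k
    have hsum : ∃ c₀ : ℝ, 0 < c₀ ∧ ∀ i, c₀ ≤ c i := by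
      refine ⟨(1 + ∑ i, (c i)⁻¹)⁻¹, ?_, fun i => ?_⟩
      · have : 0 ≤ ∑ i, (c i)⁻¹ := Finset.sum_nonneg fun i _ => (inv_pos.2 (hc i)).le
        positivity
      · have h1 : (c i)⁻¹ ≤ ∑ i, (c i)⁻¹ :=
          Finset.single_le_sum (f := fun i => (c i)⁻¹) (fun i _ => (inv_pos.2 (hc i)).le)
            (Finset.mem_univ i)
        rw [inv_le_comm₀ _ (hc i)]
        · linarith
        · have := inv_pos.2 (hc i); linarith
    obtain ⟨c₀, hc₀, hcc⟩ := hsum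
    have hcC : ∀ i, 0 ≤ c i + C i := fun i => add_nonneg (hc i).le (hC0 i)
    have hLT : ∀ i, 0 ≤ L k i * (‖T i‖ + ‖T i‖ ^ 2) := fun i => mul_nonneg (hL k i) (by positivity)
    have hcls := fun i => ((hA k i).pull (hL k i) (T i)).mono (c' := c₀)
      (C' := c₀ + ∑ i, (c i + C i)) (L' := ∑ i, L k i * (‖T i‖ + ‖T i‖ ^ 2)) (hcc i)
      (by have := Finset.single_le_sum (f := fun i => c i + C i) (fun i _ => hcC i)
            (Finset.mem_univ i)
          linarith)
      (Finset.single_le_sum (f := fun i => L k i * (‖T i‖ + ‖T i‖ ^ 2)) (fun i _ => hLT i)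
            (Finset.mem_univ i))
    have key := aux_core d _ (by
      intro l hl
      choose v hv using fun i => LinearMap.mem_range.1 (hl i)
      have : ∀ i, (v i).comp (T i) = l i := fun i => hv i
      simpa only [this] using hq v) c₀ _ _ hc₀
        (by have := Finset.sum_nonneg fun i (_ : i ∈ Finset.univ) => hcC i
            linarith) (Finset.sum_nonneg fun i _ => hLT i) _ _ hcls
    have hpi := aux_integrable_prod hc₀ d hcls (ProbabilityTheory.stdGaussian E) 0 1
    simp only [zero_add, one_smul] at hpi
    have hGpos : ∀ i z, 0 < G k i z := fun i z => (hc i).trans_le ((hA k i).lo z)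
    unfold AuxP
    have e1 : ∀ i, (∫⁻ z, ENNReal.ofReal (G k i z) ∂(ProbabilityTheory.stdGaussian (F i)))
        = ENNReal.ofReal (∫ x, G k i (T i x) ∂(ProbabilityTheory.stdGaussian E)) := by
      intro i
      have hi := (hcls i).integrable hc₀ (ProbabilityTheory.stdGaussian E) 0 1
      simp only [zero_add, one_smul] at hi
      rw [ofReal_integral_eq_lintegral_ofReal hi
        (Filter.Eventually.of_forall fun x => (hGpos i _).le), ← hT i,
        lintegral_map (hA k i).meas.ennreal_ofReal (T i).continuous.measurable]
    have hip : ∀ i, 0 < ∫ x, G k i (T i x) ∂(ProbabilityTheory.stdGaussian E) := by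
      intro i
      have hi := (hcls i).integrable hc₀ (ProbabilityTheory.stdGaussian E) 0 1
      simp only [zero_add, one_smul] at hi
      refine hc₀.trans_le ?_
      have := integral_mono (integrable_const c₀) hi (fun x => (hcls i).lo x)
      simpa using this
    simp_rw [e1, ENNReal.ofReal_rpow_of_pos (hip _), ENNReal.ofReal_rpow_of_pos (hGpos _ _)]
    have e2 : ∀ x, ∏ i, ENNReal.ofReal (G k i (T i x) ^ d i)
        = ENNReal.ofReal (∏ i, G k i (T i x) ^ d i) := fun x =>
      (ENNReal.ofReal_prod_of_nonneg fun i _ => Real.rpow_nonneg (hGpos i _).le _).symm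
    simp_rw [e2]
    rw [← ofReal_integral_eq_lintegral_ofReal hpi (Filter.Eventually.of_forall fun x =>
      Finset.prod_nonneg fun i _ => Real.rpow_nonneg (hGpos i _).le _),
      ← ENNReal.ofReal_prod_of_nonneg fun i _ => Real.rpow_nonneg (hip i).le _]
    exact ENNReal.ofReal_le_ofReal key
  · exact fun k i => (hA k i).meas.ennreal_ofReal
  · intro i
    refine tendsto_lintegral_of_dominated_convergence (fun _ => ENNReal.ofReal (c i + C i))
      (fun k => (hA k i).meas.ennreal_ofReal) (fun k => Filter.Eventually.of_forall fun z =>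
        ENNReal.ofReal_le_ofReal ((hA k i).hi z)) (by simp) (hlim i)
  · exact fun i => ENNReal.add_ne_top.2 ⟨aux_ofReal_rpow_fin (hc i),
      aux_ofReal_rpow_fin (add_pos_of_pos_of_nonneg (hc i) (hC0 i))⟩
  · exact fun k i z => aux_ofReal_rpow_bd (hc i) ((hA k i).lo z) ((hA k i).hi z)
  · intro i
    have hb1 : ENNReal.ofReal (c i)
        ≤ ∫⁻ z, ENNReal.ofReal (c i + f i z) ∂(ProbabilityTheory.stdGaussian (F i)) := by
      have := lintegral_mono (μ := ProbabilityTheory.stdGaussian (F i))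
        (f := fun _ => ENNReal.ofReal (c i)) (g := fun z => ENNReal.ofReal (c i + f i z))
        (fun z => ENNReal.ofReal_le_ofReal (by linarith [h0 i z]))
      simpa using this
    have hb2 : ∫⁻ z, ENNReal.ofReal (c i + f i z) ∂(ProbabilityTheory.stdGaussian (F i))
        ≤ ENNReal.ofReal (c i + C i) := by
      have := lintegral_mono (μ := ProbabilityTheory.stdGaussian (F i))
        (g := fun _ => ENNReal.ofReal (c i + C i)) (f := fun z => ENNReal.ofReal (c i + f i z))
        (fun z => ENNReal.ofReal_le_ofReal (by linarith [hC i z]))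
      simpa using this
    refine ENNReal.rpow_ne_top_of_ne_zero ?_ ?_
    · exact (lt_of_lt_of_le (ENNReal.ofReal_pos.2 (hc i)) hb1).ne'
    · exact ne_top_of_le_ne_top ENNReal.ofReal_ne_top hb2
end

section
variable {X : Type*} [NormedAddCommGroup X] [MeasurableSpace X] [BorelSpace X]

/-- Truncation in space and height. -/
noncomputable def auxTau (k : ℕ) (H : X → ℝ≥0∞) : X → ℝ≥0∞ :=
  (Metric.closedBall (0 : X) k).indicator (fun x => min (H x) k)

lemma auxTau_meas (k : ℕ) {H : X → ℝ≥0∞} (hH : Measurable H) : Measurable (auxTau k H) :=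
  (hH.min measurable_const).indicator measurableSet_closedBall

lemma auxTau_le (k : ℕ) (H : X → ℝ≥0∞) (x : X) : auxTau k H x ≤ H x := by
  unfold auxTau
  by_cases h : x ∈ Metric.closedBall (0 : X) k
  · rw [Set.indicator_of_mem h]; exact min_le_left _ _
  · rw [Set.indicator_of_notMem h]; exact zero_le

lemma auxTau_le_nat (k : ℕ) (H : X → ℝ≥0∞) (x : X) : auxTau k H x ≤ k := by
  unfold auxTau
  by_cases h : x ∈ Metric.closedBall (0 : X) k
  · rw [Set.indicator_of_mem h]; exact min_le_right _ _
  · rw [Set.indicator_of_notMem h]; exact zero_le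

lemma auxTau_mono (H : X → ℝ≥0∞) (x : X) : Monotone fun k => auxTau k H x := by
  intro k l hkl
  simp only [auxTau]
  by_cases h : x ∈ Metric.closedBall (0 : X) k
  · rw [Set.indicator_of_mem h,
      Set.indicator_of_mem (Metric.closedBall_subset_closedBall (by exact_mod_cast hkl) h)]
    exact min_le_min le_rfl (by exact_mod_cast hkl)
  · rw [Set.indicator_of_notMem h]; exact zero_le

lemma auxTau_tendsto (H : X → ℝ≥0∞) (x : X) :
    Filter.Tendsto (fun k => auxTau k H x) Filter.atTop (nhds (H x)) := by
  have h1 : Filter.Tendsto (fun k : ℕ => min (H x) (k : ℝ≥0∞)) Filter.atTop (nhds (min (H x) ∞)) :=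
    tendsto_const_nhds.min ENNReal.tendsto_nat_nhds_top
  rw [min_eq_left le_top] at h1
  refine h1.congr' ?_
  obtain ⟨K, hK⟩ := exists_nat_ge ‖x‖
  filter_upwards [Filter.eventually_ge_atTop K] with k hk
  have : x ∈ Metric.closedBall (0 : X) k := by
    rw [mem_closedBall_zero_iff]
    exact hK.trans (by exact_mod_cast hk)
  simp only [auxTau]
  rw [Set.indicator_of_mem this]

lemma auxTau_int (H : X → ℝ≥0∞) (hH : Measurable H) (μ : Measure X) :
    Filter.Tendsto (fun k => ∫⁻ x, auxTau k H x ∂μ) Filter.atTop (nhds (∫⁻ x, H x ∂μ)) :=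
  lintegral_tendsto_of_tendsto_of_monotone (fun k => (auxTau_meas k hH).aemeasurable)
    (Filter.Eventually.of_forall fun x => auxTau_mono H x)
    (Filter.Eventually.of_forall fun x => auxTau_tendsto H x)

lemma auxTau_ne_top (k : ℕ) (H : X → ℝ≥0∞) (x : X) : auxTau k H x ≠ ∞ :=
  ne_top_of_le_ne_top (ENNReal.natCast_ne_top k) (auxTau_le_nat k H x)

lemma auxTau_integrable (k : ℕ) (H : X → ℝ≥0∞) (hH : Measurable H) (μ : Measure X)
    [IsFiniteMeasureOnCompacts μ] [ProperSpace X] :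
    Integrable (fun x => (auxTau k H x).toReal) μ := by
  refine integrable_toReal_of_lintegral_ne_top (auxTau_meas k hH).aemeasurable ?_
  unfold auxTau
  rw [lintegral_indicator measurableSet_closedBall]
  have h1 : ∫⁻ x in Metric.closedBall (0 : X) k, min (H x) k ∂μ
      ≤ ∫⁻ x in Metric.closedBall (0 : X) k, (k : ℝ≥0∞) ∂μ :=
    lintegral_mono fun x => min_le_right _ _
  rw [setLIntegral_const] at h1
  exact ne_top_of_le_ne_top (ENNReal.mul_ne_top (ENNReal.natCast_ne_top k)
    (isCompact_closedBall _ _).measure_lt_top.ne) h1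
end

section
variable {E : Type*} [NormedAddCommGroup E] [InnerProductSpace ℝ E] [MeasurableSpace E]
  [BorelSpace E] [FiniteDimensional ℝ E] {ι : Type*} [Fintype ι] {F : ι → Type*}
  [∀ i, NormedAddCommGroup (F i)] [∀ i, InnerProductSpace ℝ (F i)] [∀ i, MeasurableSpace (F i)]
  [∀ i, BorelSpace (F i)] [∀ i, FiniteDimensional ℝ (F i)]

/-- The auxiliary approximation of `H`. -/
noncomputable def auxHat {X : Type*} [NormedAddCommGroup X] (d : ℝ) (M : ℕ) (c : ℝ)
    (H : X → ℝ≥0∞) (z : X) : ℝ≥0∞ :=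
  if 0 < d then auxTau M H z else ENNReal.ofReal c + H z

lemma aux_step4 {d : ι → ℝ} (hd : ∀ i, d i ≠ 0) {T : ∀ i, E →L[ℝ] F i}
    (hT : ∀ i, (ProbabilityTheory.stdGaussian E).map (T i) = ProbabilityTheory.stdGaussian (F i))
    (hq : ∀ l : ∀ i, F i →L[ℝ] ℝ, ∑ i, d i * ‖(l i).comp (T i)‖ ^ 2
      ≤ ‖∑ i, d i • (l i).comp (T i)‖ ^ 2)
    (H : ∀ i, F i → ℝ≥0∞) (hH : ∀ i, Measurable (H i)) (M : ℕ) (c : ℝ) (hc : 0 < c) :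
    AuxP d T (fun i => auxHat (d i) M c (H i)) := by
  let Hk : ℕ → ∀ i, F i → ℝ≥0∞ := fun k i z =>
    if 0 < d i then ENNReal.ofReal (1 / ((k : ℝ) + 1)) + auxTau M (H i) z
      else ENNReal.ofReal c + auxTau k (H i) z
  have t0 : Filter.Tendsto (fun k : ℕ => ENNReal.ofReal (1 / ((k : ℝ) + 1))) Filter.atTop
      (nhds 0) := by
    have := ENNReal.tendsto_ofReal (tendsto_one_div_add_atTop_nhds_zero_nat (𝕜 := ℝ))
    simpa using this
  refine aux_limit hT (Hk := Hk) ?_ ?_ ?_ ?_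
    (fun i => if 0 < d i then (1 + (M : ℝ≥0∞)) ^ d i else ENNReal.ofReal c ^ d i) ?_ ?_ ?_
  · intro k
    have := aux_stepA hT hq (fun i => if 0 < d i then 1 / ((k : ℝ) + 1) else c)
      (fun i => if 0 < d i then (M : ℝ) else k)
      (fun i => by split_ifs <;> positivity)
      (fun i z => (auxTau (if 0 < d i then M else k) (H i) z).toReal)
      (fun i => auxTau_integrable _ _ (hH i) _) (fun i x => ENNReal.toReal_nonneg)
      (fun i x => by
        have := ENNReal.toReal_mono (ENNReal.natCast_ne_top _)
          (auxTau_le_nat (if 0 < d i then M else k) (H i) x)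
        rw [ENNReal.toReal_natCast] at this
        split_ifs at this ⊢ <;> exact this)
    convert this using 3 with i z
    simp only [Hk]
    split_ifs
    · rw [ENNReal.ofReal_add (by positivity) ENNReal.toReal_nonneg,
        ENNReal.ofReal_toReal (auxTau_ne_top _ _ _)]
    · rw [ENNReal.ofReal_add (by positivity) ENNReal.toReal_nonneg,
        ENNReal.ofReal_toReal (auxTau_ne_top _ _ _)]
  · intro k i
    simp only [Hk]
    split_ifs
    · exact measurable_const.add (auxTau_meas _ (hH i))
    · exact measurable_const.add (auxTau_meas _ (hH i))
  · intro i
    refine Filter.Eventually.of_forall fun z => ?_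
    simp only [Hk, auxHat]
    split_ifs
    · simpa using t0.add_const (auxTau M (H i) z)
    · exact (auxTau_tendsto (H i) z).const_add _
  · intro i
    simp only [Hk, auxHat]
    split_ifs
    · simp only [lintegral_const, measure_univ, mul_one, lintegral_add_left measurable_const]
      simpa using t0.add_const (∫⁻ z, auxTau M (H i) z ∂(ProbabilityTheory.stdGaussian (F i)))
    · simp only [lintegral_const, measure_univ, mul_one, lintegral_add_left measurable_const]
      exact (auxTau_int (H i) (hH i) _).const_add _
  · intro i
    split_ifs with h
    · exact ENNReal.rpow_ne_top_of_nonneg h.le (by simp)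
    · exact aux_ofReal_rpow_fin hc
  · intro k i z
    simp only [Hk]
    split_ifs with h
    · refine ENNReal.rpow_le_rpow (add_le_add ?_ (auxTau_le_nat _ _ _)) h.le
      rw [ENNReal.ofReal_le_one]
      rw [div_le_one (by positivity)]
      simp
    · exact aux_rpow_anti (not_lt.1 h) le_self_add
  · intro i
    simp only [auxHat]
    split_ifs with h
    · refine ENNReal.rpow_ne_top_of_nonneg h.le ?_
      have := lintegral_mono (μ := ProbabilityTheory.stdGaussian (F i))
        (f := auxTau M (H i)) (g := fun _ => (M : ℝ≥0∞)) (auxTau_le_nat M (H i))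
      simp only [lintegral_const, measure_univ, mul_one] at this
      exact ne_top_of_le_ne_top (ENNReal.natCast_ne_top M) this
    · refine ne_top_of_le_ne_top (aux_ofReal_rpow_fin (d := d i) hc)
        (aux_rpow_anti (not_lt.1 h) ?_)
      simp only [lintegral_const, measure_univ, mul_one, lintegral_add_left measurable_const]
      exact le_self_add

lemma aux_tendsto_prod {α : Type*} {l : Filter α} {f : ι → α → ℝ≥0∞} {a : ι → ℝ≥0∞}
    (h : ∀ i, Filter.Tendsto (f i) l (nhds (a i))) (h0 : ∀ i, a i ≠ 0) (s : Finset ι) :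
    Filter.Tendsto (fun x => ∏ i ∈ s, f i x) l (nhds (∏ i ∈ s, a i)) := by
  classical
  induction s using Finset.induction_on with
  | empty => simpa using tendsto_const_nhds
  | insert i s hi ih =>
    simp_rw [Finset.prod_insert hi]
    exact ENNReal.Tendsto.mul (h i) (Or.inl (h0 i)) ih
      (Or.inl (Finset.prod_ne_zero_iff.2 fun j _ => h0 j))

lemma aux_all {d : ι → ℝ} (hd : ∀ i, d i ≠ 0) {T : ∀ i, E →L[ℝ] F i}
    (hT : ∀ i, (ProbabilityTheory.stdGaussian E).map (T i) = ProbabilityTheory.stdGaussian (F i))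
    (hq : ∀ l : ∀ i, F i →L[ℝ] ℝ, ∑ i, d i * ‖(l i).comp (T i)‖ ^ 2
      ≤ ‖∑ i, d i • (l i).comp (T i)‖ ^ 2)
    (H : ∀ i, F i → ℝ≥0∞) (hH : ∀ i, Measurable (H i)) : AuxP d T H := by
  by_cases hz : ∃ i, (∫⁻ z, H i z ∂(ProbabilityTheory.stdGaussian (F i))) ^ d i = 0
  · obtain ⟨i, hi⟩ := hz
    unfold AuxP
    rw [Finset.prod_eq_zero (Finset.mem_univ i) hi]
    exact zero_le
  push Not at hz
  have t0 : Filter.Tendsto (fun k : ℕ => ENNReal.ofReal (1 / ((k : ℝ) + 1))) Filter.atTop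
      (nhds 0) := by
    have := ENNReal.tendsto_ofReal (tendsto_one_div_add_atTop_nhds_zero_nat (𝕜 := ℝ))
    simpa using this
  have h4 := fun k : ℕ => aux_step4 hd hT hq H hH k (1 / ((k : ℝ) + 1)) (by positivity)
  have hlim : ∀ i, Filter.Tendsto (fun k : ℕ => (∫⁻ z, auxHat (d i) k (1 / ((k : ℝ) + 1)) (H i) z
      ∂(ProbabilityTheory.stdGaussian (F i))) ^ d i) Filter.atTop
      (nhds ((∫⁻ z, H i z ∂(ProbabilityTheory.stdGaussian (F i))) ^ d i)) := by
    intro i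
    refine (ENNReal.continuous_rpow_const.tendsto _).comp ?_
    simp only [auxHat]
    split_ifs
    · exact auxTau_int (H i) (hH i) _
    · simp only [lintegral_const, measure_univ, mul_one, lintegral_add_left measurable_const]
      simpa using t0.add_const (∫⁻ z, H i z ∂(ProbabilityTheory.stdGaussian (F i)))
  refine le_of_tendsto (aux_tendsto_prod hlim hz Finset.univ)
    (Filter.Eventually.of_forall fun k => (h4 k).trans ?_)
  refine lintegral_mono fun x => Finset.prod_le_prod' fun i _ => ?_
  simp only [auxHat]
  split_ifs with h
  · exact ENNReal.rpow_le_rpow (auxTau_le _ _ _) h.le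
  · exact aux_rpow_anti (not_lt.1 h) le_add_self
end

/-- The continuous linear map of a matrix between Euclidean spaces. -/
noncomputable def auxT {p n : ℕ} (U : Matrix (Fin p) (Fin n) ℝ) :
    EuclideanSpace ℝ (Fin n) →L[ℝ] EuclideanSpace ℝ (Fin p) :=
  LinearMap.toContinuousLinearMap (Matrix.toLpLin 2 2 U)

lemma auxT_apply {p n : ℕ} (U : Matrix (Fin p) (Fin n) ℝ) (x : EuclideanSpace ℝ (Fin n)) :
    auxT U x = WithLp.toLp 2 (U *ᵥ WithLp.ofLp x) := rfl

lemma auxT_comp {p n : ℕ} (U : Matrix (Fin p) (Fin n) ℝ) (v : EuclideanSpace ℝ (Fin p)) :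
    (innerSL ℝ v).comp (auxT U) = innerSL ℝ (WithLp.toLp 2 (Uᵀ *ᵥ WithLp.ofLp v)) := by
  ext x
  simp only [ContinuousLinearMap.comp_apply, innerSL_apply_apply, auxT_apply]
  rw [EuclideanSpace.inner_eq_star_dotProduct, EuclideanSpace.inner_eq_star_dotProduct]
  simp only [star_trivial]
  rw [Matrix.mulVec_transpose, dotProduct_comm, Matrix.dotProduct_mulVec, dotProduct_comm]

lemma aux_normsq {p : ℕ} (v : EuclideanSpace ℝ (Fin p)) :
    ‖v‖ ^ 2 = WithLp.ofLp v ⬝ᵥ WithLp.ofLp v := by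
  rw [EuclideanSpace.norm_sq_eq]
  simp [dotProduct, sq]

lemma aux_riesz {p : ℕ} (l : EuclideanSpace ℝ (Fin p) →L[ℝ] ℝ) :
    ∃ v, l = innerSL ℝ v :=
  ⟨(InnerProductSpace.toDual ℝ _).symm l, by ext x; simp⟩

lemma auxT_norm {p n : ℕ} (U : Matrix (Fin p) (Fin n) ℝ) (hU : U * Uᵀ = 1)
    (l : EuclideanSpace ℝ (Fin p) →L[ℝ] ℝ) : ‖l.comp (auxT U)‖ = ‖l‖ := by
  obtain ⟨v, rfl⟩ := aux_riesz l
  rw [auxT_comp, innerSL_apply_norm, innerSL_apply_norm]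
  rw [← sq_eq_sq₀ (norm_nonneg _) (norm_nonneg _), aux_normsq, aux_normsq]
  simp only
  rw [Matrix.dotProduct_mulVec, Matrix.vecMul_transpose, Matrix.mulVec_mulVec, hU,
    Matrix.one_mulVec]

lemma auxT_map {p n : ℕ} (U : Matrix (Fin p) (Fin n) ℝ) (hU : U * Uᵀ = 1) :
    (ProbabilityTheory.stdGaussian (EuclideanSpace ℝ (Fin n))).map (auxT U)
      = ProbabilityTheory.stdGaussian (EuclideanSpace ℝ (Fin p)) := by
  have : IsProbabilityMeasure
      ((ProbabilityTheory.stdGaussian (EuclideanSpace ℝ (Fin n))).map (auxT U)) :=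
    Measure.isProbabilityMeasure_map (auxT U).continuous.measurable.aemeasurable
  refine Measure.ext_of_charFunDual ?_
  funext l
  rw [charFunDual_map, charFunDual_stdGaussian, charFunDual_stdGaussian, auxT_norm U hU]

lemma aux_hq {m n : ℕ} (nn : Fin m → ℕ) (d : Fin m → ℝ) (hd : ∀ i, d i ≠ 0)
    (U : ∀ i, Matrix (Fin (nn i)) (Fin n) ℝ) (hU : ∀ i, U i * (U i)ᵀ = 1)
    (bigU : Matrix (Σ i : Fin m, Fin (nn i)) (Fin n) ℝ)
    (hbigU : ∀ a k, bigU a k = U a.1 a.2 k)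
    (hUD : (bigU * bigUᵀ
        - Matrix.diagonal fun a : Σ i : Fin m, Fin (nn i) => (d a.1)⁻¹).PosSemidef)
    (l : ∀ i, EuclideanSpace ℝ (Fin (nn i)) →L[ℝ] ℝ) :
    ∑ i, d i * ‖(l i).comp (auxT (U i))‖ ^ 2 ≤ ‖∑ i, d i • (l i).comp (auxT (U i))‖ ^ 2 := by
  choose v hv using fun i => aux_riesz (l i)
  have e1 : ∑ i, d i • (l i).comp (auxT (U i))
      = innerSL ℝ (∑ i, d i • WithLp.toLp 2 ((U i)ᵀ *ᵥ WithLp.ofLp (v i))) := by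
    rw [map_sum]
    refine Finset.sum_congr rfl fun i _ => ?_
    rw [hv i, auxT_comp, map_smul]
  rw [e1, innerSL_apply_norm]
  simp_rw [auxT_norm _ (hU _), hv, innerSL_apply_norm, aux_normsq]
  set w : (Σ i : Fin m, Fin (nn i)) → ℝ := fun a => d a.1 * v a.1 a.2 with hw
  have e2 : WithLp.ofLp (∑ i, d i • WithLp.toLp 2 ((U i)ᵀ *ᵥ WithLp.ofLp (v i)))
      = bigUᵀ *ᵥ w := by
    funext k
    simp only [WithLp.ofLp_sum, WithLp.ofLp_smul, Finset.sum_apply, Pi.smul_apply, smul_eq_mul,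
      mulVec, dotProduct, Matrix.transpose_apply, hbigU, hw, Fintype.sum_sigma, Finset.mul_sum]
    refine Finset.sum_congr rfl fun i _ => Finset.sum_congr rfl fun j _ => ?_
    ring
  rw [e2]
  have h := hUD.dotProduct_mulVec_nonneg w
  rw [star_trivial, Matrix.sub_mulVec, dotProduct_sub, ← Matrix.mulVec_mulVec] at h
  have e3 : w ⬝ᵥ (bigU *ᵥ (bigUᵀ *ᵥ w)) = (bigUᵀ *ᵥ w) ⬝ᵥ (bigUᵀ *ᵥ w) := by
    rw [Matrix.dotProduct_mulVec, ← Matrix.mulVec_transpose]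
  have e4 : w ⬝ᵥ ((Matrix.diagonal fun a : Σ i : Fin m, Fin (nn i) => (d a.1)⁻¹) *ᵥ w)
      = ∑ i, d i * (WithLp.ofLp (v i) ⬝ᵥ WithLp.ofLp (v i)) := by
    simp only [dotProduct, Matrix.mulVec_diagonal, hw, Fintype.sum_sigma, Finset.mul_sum]
    refine Finset.sum_congr rfl fun i _ => Finset.sum_congr rfl fun j _ => ?_
    field_simp [hd i]
  rw [e3, e4] at h
  linarith

lemma aux_transfer {p : ℕ} (g : (Fin p → ℝ) → ℝ≥0∞) (hg : Measurable g) :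
    ∫⁻ z, g z ∂(stdGaussian (Fin p))
      = ∫⁻ z, g (WithLp.ofLp z) ∂(ProbabilityTheory.stdGaussian (EuclideanSpace ℝ (Fin p))) := by
  rw [← map_pi_eq_stdGaussian, lintegral_map (f := fun z => g (WithLp.ofLp z))
    (hg.comp (by fun_prop)) (by fun_prop)]
  rfl

/-- **Theorem (Ornstein-Uhlenbeck form), lower bound**: if `U Uᵀ ≥ D⁻¹` then
`∫ ∏ fᵢ(Uᵢ x) dγₙ ≥ ∏ (∫ fᵢ^{1/dᵢ} dγ_{nᵢ})^{dᵢ}`. -/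
theorem stmt5
    (m n : ℕ) (hmn : n ≤ m) (hn : 0 < n)
    (nn : Fin m → ℕ) (hnn : ∀ i, 0 < nn i) (hnnle : ∀ i, nn i ≤ n)
    (d : Fin m → ℝ) (hd : ∀ i, d i ≠ 0)
    (U : ∀ i, Matrix (Fin (nn i)) (Fin n) ℝ)
    (hU : ∀ i, U i * (U i)ᵀ = 1)
    (bigU : Matrix (Σ i : Fin m, Fin (nn i)) (Fin n) ℝ)
    (hbigU : ∀ a k, bigU a k = U a.1 a.2 k)
    (hUD : (bigU * bigUᵀ
        - Matrix.diagonal fun a : Σ i : Fin m, Fin (nn i) => (d a.1)⁻¹).PosSemidef)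
    (f : ∀ i, (Fin (nn i) → ℝ) → ℝ)
    (hmeas : ∀ i, Measurable (f i)) (hpos : ∀ i x, 0 ≤ f i x) :
    ∏ i, (∫⁻ z, ENNReal.ofReal (f i z) ^ (1 / d i)
          ∂(stdGaussian (Fin (nn i)))) ^ (d i)
      ≤ ∫⁻ x, ∏ i, ENNReal.ofReal (f i ((U i).mulVec x)) ∂(stdGaussian (Fin n)) := by
  have hm : ∀ i, Measurable fun z => ENNReal.ofReal (f i z) ^ (1 / d i) :=
    fun i => (hmeas i).ennreal_ofReal.pow_const _
  have key : AuxP d (fun i => auxT (U i))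
      (fun i z => ENNReal.ofReal (f i (WithLp.ofLp z)) ^ (1 / d i)) :=
    aux_all hd (fun i => auxT_map (U i) (hU i)) (aux_hq nn d hd U hU bigU hbigU hUD) _
      (fun i => (hm i).comp (by fun_prop))
  unfold AuxP at key
  have hm2 : Measurable fun x : Fin n → ℝ => ∏ i, ENNReal.ofReal (f i ((U i).mulVec x)) := by
    refine Finset.measurable_prod _ fun i _ => ?_
    have h1 : Measurable fun x : Fin n → ℝ => (U i).mulVec x :=
      (Continuous.matrix_mulVec continuous_const continuous_id).measurable
    exact ((hmeas i).comp h1).ennreal_ofReal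
  rw [aux_transfer _ hm2]
  simp_rw [fun i => aux_transfer _ (hm i)]
  refine key.trans (le_of_eq ?_)
  refine lintegral_congr fun x => Finset.prod_congr rfl fun i _ => ?_
  rw [← ENNReal.rpow_mul, one_div_mul_cancel (hd i), ENNReal.rpow_one]
  rfl
end

section
/- (Geometric Brascamp–Lieb inequality for Gaussian measures.) Let n ≤ m and n₁,…,n_m ≤ n be positive integers. For each 1 ≤ i ≤ m, let Uᵢ be an nᵢ×n real matrix with UᵢUᵢ* = I_{nᵢ} and let pᵢ > 0, and set P = diag(p₁I_{n₁},…,p_mI_{n_m}) and let U be the matrix with block rows U₁,…,U_m. Assume U*P⁻¹U = I_n, i.e. ∑_{i=1}^m pᵢ⁻¹ Uᵢ*Uᵢ = I_n. Then for all measurable functions fᵢ : ℝ^{nᵢ} → [0,∞), ∫_{ℝⁿ} ∏_{i=1}^m fᵢ(Uᵢx) dγₙ(x) ≤ ∏_{i=1}^m ‖fᵢ‖_{L_{pᵢ}(γ_{nᵢ})}, where ‖fᵢ‖_{L_{pᵢ}(γ_{nᵢ})} = (∫_{ℝ^{nᵢ}} fᵢ^{pᵢ} dγ_{nᵢ})^{1/pᵢ}.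 -/
open MeasureTheory ProbabilityTheory Matrix
open scoped ENNReal

section BL

open scoped RealInnerProductSpace
open Filter Topology

/-- Third order upper bound for the exponential. -/
lemma bl_exp_bound (x : ℝ) (n : ℕ) :
    |Real.exp x - ∑ m ∈ Finset.range n, x ^ m / m.factorial| ≤ |x| ^ n * Real.exp |x| := by
  have h := Complex.norm_exp_sub_sum_le_norm_mul_exp (x : ℂ) n
  rw [Complex.norm_real, Real.norm_eq_abs] at h
  rw [← Real.norm_eq_abs, ← Complex.norm_real]
  push_cast
  exact h

lemma bl_exp_two (x : ℝ) : |Real.exp x - 1 - x| ≤ x ^ 2 * Real.exp |x| := by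
  have h := bl_exp_bound x 2
  simp [Finset.sum_range_succ] at h
  convert h using 2
  ring

lemma bl_exp_three (x : ℝ) : |Real.exp x - 1 - x - x ^ 2 / 2| ≤ |x| ^ 3 * Real.exp |x| := by
  have h := bl_exp_bound x 3
  simp [Finset.sum_range_succ, Nat.factorial] at h
  convert h using 2
  ring

lemma bl_abs_le (t : ℝ) : |t| ≤ Real.exp |t| * |Real.exp t - 1| := by
  rcases le_total 0 t with h | h
  · rw [abs_of_nonneg h, abs_of_nonneg (by linarith [Real.add_one_le_exp t])]
    have h1 := Real.add_one_le_exp t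
    have h2 : 1 ≤ Real.exp t := Real.one_le_exp h
    nlinarith
  · have h2 : Real.exp t ≤ 1 := Real.exp_le_one_iff.2 h
    rw [abs_of_nonpos h, abs_of_nonpos (by linarith)]
    have h1 := Real.add_one_le_exp (-t)
    have h3 : Real.exp (-t) * Real.exp t = 1 := by rw [← Real.exp_add]; simp
    nlinarith

/-- Pointwise Taylor estimate. -/
lemma bl_pointwise {ι : Type*} [Fintype ι] (c : ι → ℝ) (hc : ∀ i, 0 < c i) (T B : ℝ)
    (hB : 0 ≤ B) :
    ∃ K, 0 ≤ K ∧ ∀ (τ : ℝ) (t l : ι → ℝ), 0 ≤ τ → (∀ i, |t i| ≤ T) → (∀ i, |l i| ≤ B * τ) →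
      (∀ i, |Real.exp (t i) - 1| ≤ B * τ) → (∀ i, |Real.exp (t i) - 1 - l i| ≤ B * τ ^ 2) →
      Real.exp (∑ i, c i * t i) ≤ 1 + ∑ i, c i * (Real.exp (t i) - 1)
        + ((∑ i, c i * l i) ^ 2 - ∑ i, c i * l i ^ 2) / 2 + K * τ ^ 3 := by
  set C := ∑ i, c i with hC
  have hC0 : 0 ≤ C := Finset.sum_nonneg fun i _ => (hc i).le
  set e := Real.exp T with he
  have he0 : 0 < e := Real.exp_pos T
  set B1 := e * B with hB1
  have hB10 : 0 ≤ B1 := by positivity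
  set B4 := B1 ^ 2 * e + B with hB4
  have hB40 : 0 ≤ B4 := by positivity
  refine ⟨(C * B1) ^ 3 * Real.exp (C * T) + C * (B1 ^ 3 * e) + (C * B4) * (C * (B1 + B)) / 2
    + C * (B4 * (B1 + B)) / 2, by positivity, ?_⟩
  intro τ t l hτ ht hl hy hyl
  have hexp : ∀ i, Real.exp |t i| ≤ e := fun i => Real.exp_le_exp.2 (ht i)
  have h1 : ∀ i, |t i| ≤ B1 * τ := fun i => by
    calc |t i| ≤ Real.exp |t i| * |Real.exp (t i) - 1| := bl_abs_le _
      _ ≤ e * (B * τ) := by gcongr <;> [exact hexp i; exact hy i]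
      _ = _ := by rw [hB1]; ring
  have h2 : ∀ i, |Real.exp (t i) - 1 - t i| ≤ B1 ^ 2 * e * τ ^ 2 := fun i => by
    calc _ ≤ t i ^ 2 * Real.exp |t i| := bl_exp_two _
      _ = |t i| ^ 2 * Real.exp |t i| := by rw [sq_abs]
      _ ≤ (B1 * τ) ^ 2 * e := by gcongr <;> [exact h1 i; exact hexp i]
      _ = _ := by ring
  have h3 : ∀ i, |Real.exp (t i) - 1 - t i - t i ^ 2 / 2| ≤ B1 ^ 3 * e * τ ^ 3 := fun i => by
    calc _ ≤ |t i| ^ 3 * Real.exp |t i| := bl_exp_three _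
      _ ≤ (B1 * τ) ^ 3 * e := by gcongr <;> [exact h1 i; exact hexp i]
      _ = _ := by ring
  have h4 : ∀ i, |t i - l i| ≤ B4 * τ ^ 2 := fun i => by
    have := abs_le.1 (h2 i)
    have := abs_le.1 (hyl i)
    rw [abs_le, hB4]; constructor <;> nlinarith
  have h5 : ∀ i, |t i + l i| ≤ (B1 + B) * τ := fun i => by
    have := abs_add_le (t i) (l i)
    have := h1 i
    have := hl i
    nlinarith
  have h6 : ∀ i, l i ^ 2 - t i ^ 2 ≤ B4 * (B1 + B) * τ ^ 3 := fun i => by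
    calc l i ^ 2 - t i ^ 2 ≤ |(t i - l i) * (t i + l i)| := by
          rw [← abs_neg]; refine le_trans (le_of_eq ?_) (le_abs_self _); ring
      _ = |t i - l i| * |t i + l i| := abs_mul _ _
      _ ≤ (B4 * τ ^ 2) * ((B1 + B) * τ) := by gcongr <;> [exact h4 i; exact h5 i]
      _ = _ := by ring
  have hsum : ∀ (v : ι → ℝ) (D : ℝ), (∀ i, |v i| ≤ D) → |∑ i, c i * v i| ≤ C * D := by
    intro v D hv
    calc _ ≤ ∑ i, |c i * v i| := Finset.abs_sum_le_sum_abs _ _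
      _ ≤ ∑ i, c i * D := by
        refine Finset.sum_le_sum fun i _ => ?_
        rw [abs_mul, abs_of_pos (hc i)]
        exact mul_le_mul_of_nonneg_left (hv i) (hc i).le
      _ = _ := by rw [hC, Finset.sum_mul]
  have hsum' : ∀ (v : ι → ℝ) (D : ℝ), (∀ i, v i ≤ D) → ∑ i, c i * v i ≤ C * D := by
    intro v D hv
    calc _ ≤ ∑ i, c i * D := 
          Finset.sum_le_sum fun i _ => mul_le_mul_of_nonneg_left (hv i) (hc i).le
      _ = _ := by rw [hC, Finset.sum_mul]
  set W := ∑ i, c i * t i with hW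
  have hW1 : |W| ≤ C * T := hsum _ _ ht
  have hW2 : |W| ≤ C * (B1 * τ) := hsum _ _ h1
  have hE : Real.exp W ≤ 1 + W + W ^ 2 / 2 + (C * B1) ^ 3 * Real.exp (C * T) * τ ^ 3 := by
    have h := (abs_le.1 (bl_exp_three W)).2
    have h' : |W| ^ 3 * Real.exp |W| ≤ (C * (B1 * τ)) ^ 3 * Real.exp (C * T) := by
      gcongr
    have : (C * (B1 * τ)) ^ 3 * Real.exp (C * T) = (C * B1) ^ 3 * Real.exp (C * T) * τ ^ 3 := by
      ring
    linarith
  have hWle : W ≤ ∑ i, c i * (Real.exp (t i) - 1) - (∑ i, c i * t i ^ 2) / 2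
      + C * (B1 ^ 3 * e * τ ^ 3) := by
    have := hsum' (fun i => t i - (Real.exp (t i) - 1) + t i ^ 2 / 2) _ fun i => by
      have := (abs_le.1 (h3 i)).1
      show _ ≤ B1 ^ 3 * e * τ ^ 3
      linarith
    have h7 : ∑ i, c i * (t i - (Real.exp (t i) - 1) + t i ^ 2 / 2)
      = W - ∑ i, c i * (Real.exp (t i) - 1) + (∑ i, c i * t i ^ 2) / 2 := by
      rw [hW, Finset.sum_div, ← Finset.sum_sub_distrib, ← Finset.sum_add_distrib]
      exact Finset.sum_congr rfl fun i _ => by ring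
    linarith
  have hsq : - ∑ i, c i * t i ^ 2 ≤ - ∑ i, c i * l i ^ 2 + C * (B4 * (B1 + B) * τ ^ 3) := by
    have := hsum' (fun i => l i ^ 2 - t i ^ 2) _ h6
    simp only [mul_sub, Finset.sum_sub_distrib] at this
    linarith
  have hWsq : W ^ 2 ≤ (∑ i, c i * l i) ^ 2 + (C * B4) * (C * (B1 + B)) * τ ^ 3 := by
    have e1 : W ^ 2 - (∑ i, c i * l i) ^ 2
        = (∑ i, c i * (t i - l i)) * (∑ i, c i * (t i + l i)) := by
      simp only [mul_sub, mul_add, Finset.sum_sub_distrib, Finset.sum_add_distrib]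
      rw [hW]; ring
    have e2 := le_abs_self ((∑ i, c i * (t i - l i)) * (∑ i, c i * (t i + l i)))
    rw [abs_mul] at e2
    have e3 : |∑ i, c i * (t i - l i)| * |∑ i, c i * (t i + l i)|
        ≤ (C * (B4 * τ ^ 2)) * (C * ((B1 + B) * τ)) := by
      gcongr <;> [exact hsum _ _ h4; exact hsum _ _ h5]
    have : (C * (B4 * τ ^ 2)) * (C * ((B1 + B) * τ)) = (C * B4) * (C * (B1 + B)) * τ ^ 3 := by ring
    linarith
  nlinarith


section core

variable {E : Type*} [NormedAddCommGroup E] [InnerProductSpace ℝ E] [FiniteDimensional ℝ E]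
  [MeasurableSpace E] [BorelSpace E]

/-- The Mathlib standard Gaussian measure. -/
noncomputable abbrev blG (E : Type*) [NormedAddCommGroup E] [InnerProductSpace ℝ E]
    [FiniteDimensional ℝ E] [MeasurableSpace E] : Measure E := ProbabilityTheory.stdGaussian E

lemma blG_inner (w : E) : ∫ z, ⟪w, z⟫ ∂(blG E) = 0 := by
  have := integral_strongDual_stdGaussian (innerSL ℝ w)
  simpa using this

lemma blG_inner_sq (w : E) : ∫ z, ⟪w, z⟫ ^ 2 ∂(blG E) = ‖w‖ ^ 2 := by
  have h := variance_dual_stdGaussian (innerSL ℝ w)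
  rw [variance_of_integral_eq_zero (by fun_prop) (integral_strongDual_stdGaussian _)] at h
  simpa using h

lemma blG_integrable_pow (k : ℕ) : Integrable (fun z : E => (1 + ‖z‖) ^ k) (blG E) := by
  have h2 : MemLp (fun z : E => ‖z‖) k (blG E) :=
    (IsGaussian.memLp_id (blG E) k (by simp)).norm
  have h1 : MemLp (fun _ : E => (1 : ℝ)) k (blG E) := memLp_const 1
  have h : MemLp (fun z : E => 1 + ‖z‖) k (blG E) := h1.add h2
  have := h.integrable_norm_pow'
  refine this.congr (Eventually.of_forall fun z => ?_)
  simp only [Real.norm_eq_abs]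
  rw [abs_of_nonneg (by positivity)]

lemma blG_integrable_norm_sq : Integrable (fun z : E => ‖z‖ ^ 2) (blG E) := by
  refine (blG_integrable_pow 2).mono' (by fun_prop) (Eventually.of_forall fun z => ?_)
  rw [Real.norm_eq_abs, abs_of_nonneg (by positivity)]
  have := norm_nonneg z
  nlinarith

lemma blG_integrable_inner (w : E) : Integrable (fun z : E => ⟪w, z⟫) (blG E) := by
  have := (innerSL ℝ w).integrable_comp (IsGaussian.integrable_id (μ := blG E))
  simpa using this

lemma blG_integrable_inner_sq (w : E) : Integrable (fun z : E => ⟪w, z⟫ ^ 2) (blG E) := by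
  refine (blG_integrable_norm_sq.const_mul (‖w‖ ^ 2)).mono' (by fun_prop)
    (Eventually.of_forall fun z => ?_)
  rw [Real.norm_eq_abs, abs_of_nonneg (by positivity), ← mul_pow, ← sq_abs]
  gcongr
  exact abs_real_inner_le_norm w z

/-- Regularity class: bounded between `a` and `b`, with a bounded gradient fixed by `A` and a
uniform second order Taylor estimate. -/
structure BLReg (a b L : ℝ) (A : E →L[ℝ] E) (h : E → ℝ) (G : E → E) : Prop where
  mh : Measurable h
  mG : Measurable G
  lo : ∀ x, a ≤ h x
  hi : ∀ x, h x ≤ b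
  bG : ∀ x, ‖G x‖ ≤ L
  fix : ∀ x, A (G x) = G x
  tay : ∀ x y, |h (x + y) - h x - ⟪G x, y⟫| ≤ L * ‖y‖ ^ 2

/-- Gaussian averaging. -/
noncomputable def blT {F : Type*} [NormedAddCommGroup F] [NormedSpace ℝ F] (r : ℝ) (h : E → F)
    (x : E) : F := ∫ z, h (x + r • z) ∂(blG E)

lemma bl_bdd_integrable {F : Type*} [NormedAddCommGroup F] {X : Type*} [MeasurableSpace X]
    {μ : Measure X} [IsFiniteMeasure μ] {h : X → F} (hm : AEStronglyMeasurable h μ) (D : ℝ)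
    (hD : ∀ x, ‖h x‖ ≤ D) : Integrable h μ :=
  Integrable.of_bound hm D (Eventually.of_forall hD)

lemma BLReg.abs_le {a b L : ℝ} (ha : 0 < a) {A : E →L[ℝ] E} {h : E → ℝ} {G : E → E}
    (H : BLReg a b L A h G) (x : E) : ‖h x‖ ≤ b := by
  rw [Real.norm_eq_abs, abs_of_pos (ha.trans_le (H.lo x))]
  exact H.hi x

lemma BLReg.integrable {a b L : ℝ} (ha : 0 < a) {A : E →L[ℝ] E} {h : E → ℝ} {G : E → E}
    (H : BLReg a b L A h G) (r : ℝ) (x : E) : Integrable (fun z => h (x + r • z)) (blG E) := by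
  have := H.mh
  exact bl_bdd_integrable (Measurable.aestronglyMeasurable (by fun_prop)) b
    fun z => H.abs_le ha _

lemma BLReg.integrableG {a b L : ℝ} {A : E →L[ℝ] E} {h : E → ℝ} {G : E → E}
    (H : BLReg a b L A h G) (r : ℝ) (x : E) : Integrable (fun z => G (x + r • z)) (blG E) := by
  have := H.mG
  exact bl_bdd_integrable (Measurable.aestronglyMeasurable (by fun_prop)) L fun z => H.bG _

lemma BLReg.avg {a b L : ℝ} (ha : 0 < a) {A : E →L[ℝ] E} {h : E → ℝ} {G : E → E}
    (H : BLReg a b L A h G) (r : ℝ) : BLReg a b L A (blT r h) (blT r G) := by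
  have mh := H.mh
  have mG := H.mG
  refine ⟨?_, ?_, ?_, ?_, ?_, ?_, ?_⟩
  · refine (StronglyMeasurable.integral_prod_right' (f := fun p : E × E => h (p.1 + r • p.2))
      (ν := blG E) ?_).measurable
    exact Measurable.stronglyMeasurable (by fun_prop)
  · refine (StronglyMeasurable.integral_prod_right' (f := fun p : E × E => G (p.1 + r • p.2))
      (ν := blG E) ?_).measurable
    exact Measurable.stronglyMeasurable (by fun_prop)
  · intro x
    have := integral_mono (μ := blG E) (integrable_const a) (H.integrable ha r x)
      fun z => H.lo (x + r • z)
    simpa [blT] using this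
  · intro x
    have := integral_mono (μ := blG E) (H.integrable ha r x) (integrable_const b)
      fun z => H.hi (x + r • z)
    simpa [blT] using this
  · intro x
    have := norm_integral_le_of_norm_le_const (μ := blG E) (f := fun z => G (x + r • z))
      (Eventually.of_forall fun z => H.bG (x + r • z))
    simpa [blT] using this
  · intro x
    show A (∫ z, G (x + r • z) ∂(blG E)) = ∫ z, G (x + r • z) ∂(blG E)
    rw [← ContinuousLinearMap.integral_comp_comm _ (H.integrableG r x)]
    simp only [H.fix]
  · intro x y
    have e1 : ⟪blT r G x, y⟫ = ∫ z, ⟪G (x + r • z), y⟫ ∂(blG E) := by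
      have := (innerSL ℝ y).integral_comp_comm (H.integrableG r x)
      simp only [innerSL_apply_apply] at this
      rw [real_inner_comm, blT, ← this]
      simp only [real_inner_comm]
    have hi : Integrable (fun z => ⟪G (x + r • z), y⟫) (blG E) := by
      have := (innerSL ℝ y).integrable_comp (H.integrableG r x)
      refine this.congr (Eventually.of_forall fun z => ?_)
      simp [real_inner_comm]
    have hi2 : Integrable (fun z => h (x + y + r • z) - h (x + r • z)) (blG E) :=
      (H.integrable ha r _).sub (H.integrable ha r _)
    rw [e1, blT, blT, ← integral_sub (H.integrable ha r _) (H.integrable ha r _),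
      ← integral_sub hi2 hi, ← Real.norm_eq_abs]
    have := norm_integral_le_of_norm_le_const (μ := blG E) (C := L * ‖y‖ ^ 2)
      (f := fun z => h (x + y + r • z) - h (x + r • z) - ⟪G (x + r • z), y⟫)
      (Eventually.of_forall fun z => by
        have := H.tay (x + r • z) y
        rw [Real.norm_eq_abs]
        convert this using 5
        abel)
    simpa using this

/-- One small step. -/
lemma bl_one_step {ι : Type*} [Fintype ι] (c : ι → ℝ) (hc : ∀ i, 0 < c i)
    (A : ι → E →L[ℝ] E)
    (hA : ∀ w : ι → E, (∀ i, A i (w i) = w i) → ‖∑ i, c i • w i‖ ^ 2 ≤ ∑ i, c i * ‖w i‖ ^ 2)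
    (a b L : ℝ) (ha : 0 < a) (hab : a ≤ b) (hL : 0 ≤ L) :
    ∃ K, 0 ≤ K ∧ ∀ (σ : ℝ) (h : ι → E → ℝ) (G : ι → E → E), 0 ≤ σ → σ ≤ 1 →
      (∀ i, BLReg a b L (A i) (h i) (G i)) → ∀ x : E,
      ∫ z, ∏ i, h i (x + σ • z) ^ c i ∂(blG E) ≤ (1 + K * σ ^ 3) * ∏ i, blT σ (h i) x ^ c i := by
  set m2 := ∫ z : E, ‖z‖ ^ 2 ∂(blG E) with hm2
  have hm20 : 0 ≤ m2 := integral_nonneg fun z => by positivity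
  have hb : 0 < b := ha.trans_le hab
  obtain ⟨K, hK, hpt⟩ := bl_pointwise c hc (Real.log (b / a)) (2 * (L / a) * (1 + m2))
    (by positivity)
  refine ⟨K * ∫ z : E, (1 + ‖z‖) ^ 6 ∂(blG E),
    mul_nonneg hK (integral_nonneg fun z => by positivity), ?_⟩
  intro σ h G hσ0 hσ1 H x
  set M : ι → ℝ := fun i => blT σ (h i) x with hM
  have HT := fun i => (H i).avg ha σ
  have hMa : ∀ i, a ≤ M i := fun i => (HT i).lo x
  have hMb : ∀ i, M i ≤ b := fun i => (HT i).hi x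
  have hM0 : ∀ i, 0 < M i := fun i => ha.trans_le (hMa i)
  set u : ι → E := fun i => (M i)⁻¹ • G i x with hu
  set Y : ι → E → ℝ := fun i z => h i (x + σ • z) / M i - 1 with hY
  have hh0 : ∀ i z, 0 < h i z := fun i z => ha.trans_le ((H i).lo z)
  -- the mean is close to the value
  have hMx : ∀ i, |M i - h i x| ≤ L * σ ^ 2 * m2 := by
    intro i
    have e1 : M i - h i x = ∫ z, (h i (x + σ • z) - h i x - ⟪G i x, σ • z⟫) ∂(blG E) := by
      have hin : Integrable (fun z : E => ⟪G i x, σ • z⟫) (blG E) := by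
        simp only [inner_smul_right]
        exact (blG_integrable_inner _).const_mul σ
      have hi2 : Integrable (fun z => h i (x + σ • z) - h i x) (blG E) :=
        ((H i).integrable ha σ x).sub (integrable_const _)
      rw [integral_sub hi2 hin,
        integral_sub ((H i).integrable ha σ x) (integrable_const _)]
      simp only [inner_smul_right, integral_const_mul, blG_inner]
      simp [hM, blT]
    rw [e1, hm2, ← integral_const_mul, ← Real.norm_eq_abs]
    refine norm_integral_le_of_norm_le (blG_integrable_norm_sq.const_mul _)
      (Eventually.of_forall fun z => ?_)
    have := (H i).tay x (σ • z)
    rw [Real.norm_eq_abs]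
    refine this.trans (le_of_eq ?_)
    rw [norm_smul, mul_pow, Real.norm_eq_abs, sq_abs]
    ring
  have hmain : ∀ z, ∏ i, h i (x + σ • z) ^ c i ≤ (∏ i, M i ^ c i) *
      (1 + ∑ i, c i * Y i z + ((∑ i, c i * (σ * ⟪u i, z⟫)) ^ 2
        - ∑ i, c i * (σ * ⟪u i, z⟫) ^ 2) / 2 + K * (σ * (1 + ‖z‖) ^ 2) ^ 3) := by
    intro z
    set t : ι → ℝ := fun i => Real.log (h i (x + σ • z) / M i) with ht
    have hq0 : ∀ i, 0 < h i (x + σ • z) / M i := fun i => div_pos (hh0 i _) (hM0 i)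
    have het : ∀ i, Real.exp (t i) = h i (x + σ • z) / M i := fun i => Real.exp_log (hq0 i)
    have hz := norm_nonneg z
    have hl : ∀ i, |σ * ⟪u i, z⟫| ≤ (L / a) * (σ * (1 + ‖z‖)) := by
      intro i
      have h1 : ‖u i‖ ≤ L / a := by
        simp only [hu]
        rw [norm_smul, norm_inv, Real.norm_eq_abs, abs_of_pos (hM0 i), div_eq_inv_mul]
        gcongr
        · exact hMa i
        · exact (H i).bG x
      calc |σ * ⟪u i, z⟫| = σ * |⟪u i, z⟫| := by rw [abs_mul, abs_of_nonneg hσ0]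
        _ ≤ σ * (‖u i‖ * ‖z‖) := by gcongr; exact abs_real_inner_le_norm _ _
        _ ≤ σ * ((L / a) * (1 + ‖z‖)) := by gcongr; linarith
        _ = _ := by ring
    have hyl : ∀ i, |Real.exp (t i) - 1 - σ * ⟪u i, z⟫|
        ≤ (L / a) * (1 + m2) * (σ ^ 2 * (1 + ‖z‖) ^ 2) := by
      intro i
      have e1 : Real.exp (t i) - 1 - σ * ⟪u i, z⟫ =
          (M i)⁻¹ * ((h i (x + σ • z) - h i x - ⟪G i x, σ • z⟫) - (M i - h i x)) := by
        rw [het]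
        simp only [hu, inner_smul_right, real_inner_smul_left]
        have := (hM0 i).ne'
        field_simp
        ring
      have e2 := (H i).tay x (σ • z)
      rw [norm_smul, mul_pow, Real.norm_eq_abs, sq_abs] at e2
      have e3 := abs_sub (h i (x + σ • z) - h i x - ⟪G i x, σ • z⟫) (M i - h i x)
      have e4 : |(h i (x + σ • z) - h i x - ⟪G i x, σ • z⟫) - (M i - h i x)|
        ≤ L * (1 + m2) * (σ ^ 2 * (1 + ‖z‖) ^ 2) := by
        have h5 := hMx i
        have h6 : L * (σ ^ 2 * ‖z‖ ^ 2) + L * σ ^ 2 * m2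
            ≤ L * (1 + m2) * (σ ^ 2 * (1 + ‖z‖) ^ 2) := by
          have : ‖z‖ ^ 2 + m2 ≤ (1 + m2) * (1 + ‖z‖) ^ 2 := by nlinarith [mul_nonneg hm20 hz, mul_nonneg hm20 (sq_nonneg ‖z‖)]
          calc _ = L * σ ^ 2 * (‖z‖ ^ 2 + m2) := by ring
            _ ≤ L * σ ^ 2 * ((1 + m2) * (1 + ‖z‖) ^ 2) := by gcongr
            _ = _ := by ring
        linarith
      rw [e1, abs_mul, abs_of_pos (inv_pos.2 (hM0 i))]
      calc _ ≤ a⁻¹ * (L * (1 + m2) * (σ ^ 2 * (1 + ‖z‖) ^ 2)) := by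
            gcongr
            exact hMa i
        _ = _ := by ring
    have hR : 1 + ‖z‖ ≤ (1 + ‖z‖) ^ 2 := by nlinarith
    have hLa : 0 ≤ L / a := by positivity
    have hl' : ∀ i, |σ * ⟪u i, z⟫| ≤ (L / a) * (1 + m2) * (σ * (1 + ‖z‖) ^ 2) := fun i => by
      refine (hl i).trans ?_
      rw [mul_assoc (L / a)]
      refine mul_le_mul_of_nonneg_left ?_ hLa
      calc σ * (1 + ‖z‖) ≤ 1 * (σ * (1 + ‖z‖) ^ 2) := by rw [one_mul]; gcongr
        _ ≤ _ := by gcongr; linarith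
    have hyl' : ∀ i, |Real.exp (t i) - 1 - σ * ⟪u i, z⟫|
        ≤ (L / a) * (1 + m2) * (σ * (1 + ‖z‖) ^ 2) := fun i => by
      refine (hyl i).trans ?_
      gcongr
      nlinarith
    have key := hpt (σ * (1 + ‖z‖) ^ 2) t (fun i => σ * ⟪u i, z⟫) (by positivity) ?_ ?_ ?_ ?_
    · have e1 : ∏ i, h i (x + σ • z) ^ c i = (∏ i, M i ^ c i) * Real.exp (∑ i, c i * t i) := by
        rw [Real.exp_sum, ← Finset.prod_mul_distrib]
        refine Finset.prod_congr rfl fun i _ => ?_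
        rw [mul_comm (c i), Real.exp_mul, het, Real.div_rpow (hh0 i _).le (hM0 i).le,
          mul_div_cancel₀]
        exact (Real.rpow_pos_of_pos (hM0 i) _).ne'
      rw [e1]
      refine mul_le_mul_of_nonneg_left ?_ (Finset.prod_nonneg fun i _ =>
        (Real.rpow_pos_of_pos (hM0 i) _).le)
      simp only [het] at key
      exact key
    · intro i
      have h1 : h i (x + σ • z) / M i ≤ b / a := div_le_div₀ hb.le ((H i).hi _) ha (hMa i)
      have h2 : a / b ≤ h i (x + σ • z) / M i := 
        div_le_div₀ (hh0 i _).le ((H i).lo _) (hM0 i) (hMb i)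
      rw [abs_le]
      constructor
      · rw [← Real.log_inv, inv_div]
        exact Real.log_le_log (by positivity) h2
      · exact Real.log_le_log (hq0 i) h1
    · intro i
      refine (hl' i).trans ?_
      have : 0 ≤ (L / a) * (1 + m2) * (σ * (1 + ‖z‖) ^ 2) := by positivity
      linarith
    · intro i
      have e1 := abs_add_le (Real.exp (t i) - 1 - σ * ⟪u i, z⟫) (σ * ⟪u i, z⟫)
      rw [sub_add_cancel] at e1
      have := hl' i
      have := hyl' i
      linarith
    · intro i
      refine (hyl i).trans ?_
      have : 0 ≤ (L / a) * (1 + m2) := by positivity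
      calc _ ≤ (L / a) * (1 + m2) * (2 * (σ ^ 2 * (1 + ‖z‖) ^ 2 * (1 + ‖z‖) ^ 2)) := by
            refine mul_le_mul_of_nonneg_left ?_ this
            have : 1 ≤ (1 + ‖z‖) ^ 2 := by nlinarith
            have h3 : 0 ≤ σ ^ 2 * (1 + ‖z‖) ^ 2 := by positivity
            nlinarith
        _ = _ := by ring
  have hYi : ∀ i, Integrable (Y i) (blG E) := fun i =>
    (((H i).integrable ha σ x).div_const _).sub (integrable_const _)
  have hY0 : ∀ i, ∫ z, Y i z ∂(blG E) = 0 := fun i => by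
    simp only [hY]
    rw [integral_sub (((H i).integrable ha σ x).div_const _) (integrable_const _),
      integral_div]
    have : ∫ z, h i (x + σ • z) ∂(blG E) = M i := rfl
    rw [this, div_self (hM0 i).ne']
    simp
  have hform : ∀ z : E, ∑ i, c i * (σ * ⟪u i, z⟫) = σ * ⟪∑ i, c i • u i, z⟫ := fun z => by
    rw [sum_inner, Finset.mul_sum]
    refine Finset.sum_congr rfl fun i _ => ?_
    rw [real_inner_smul_left (u i) z (c i)]; ring
  simp only [hform] at hmain
  have i1 : Integrable (fun z => 1 + ∑ i, c i * Y i z) (blG E) :=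
    (integrable_const _).add (integrable_finsetSum _ fun i _ => (hYi i).const_mul _)
  have i2 : Integrable (fun z => (σ * ⟪∑ i, c i • u i, z⟫) ^ 2) (blG E) := by
    simp only [mul_pow]
    exact (blG_integrable_inner_sq _).const_mul _
  have i3 : ∀ i, Integrable (fun z => c i * (σ * ⟪u i, z⟫) ^ 2) (blG E) := fun i => by
    simp only [mul_pow]
    exact ((blG_integrable_inner_sq _).const_mul _).const_mul _
  have i3' : Integrable (fun z => ∑ i, c i * (σ * ⟪u i, z⟫) ^ 2) (blG E) :=
    integrable_finsetSum _ fun i _ => i3 i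
  have e4 : ∀ z : E, K * (σ * (1 + ‖z‖) ^ 2) ^ 3 = K * σ ^ 3 * (1 + ‖z‖) ^ 6 := fun z => by ring
  simp only [e4] at hmain
  have i4 : Integrable (fun z : E => K * σ ^ 3 * (1 + ‖z‖) ^ 6) (blG E) :=
    (blG_integrable_pow 6).const_mul _
  have hP : 0 ≤ ∏ i, M i ^ c i := Finset.prod_nonneg fun i _ =>
        (Real.rpow_pos_of_pos (hM0 i) _).le
  refine (integral_mono_of_nonneg (Eventually.of_forall fun z => ?_)
    (((i1.add ((i2.sub i3').div_const 2)).add i4).const_mul (∏ i, M i ^ c i))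
    (Eventually.of_forall hmain)).trans ?_
  · exact Finset.prod_nonneg fun i _ => (Real.rpow_pos_of_pos (hh0 i _) _).le
  · rw [integral_const_mul, mul_comm]
    refine mul_le_mul_of_nonneg_right ?_ hP
    have s1 : ∫ z, (1 + ∑ i, c i * Y i z) ∂(blG E) = 1 := by
      rw [integral_add (integrable_const _)
        (integrable_finsetSum _ fun i _ => (hYi i).const_mul _),
        integral_finsetSum _ fun i _ => (hYi i).const_mul _]
      simp [integral_const_mul, hY0]
    have s2 : ∫ z, (σ * ⟪∑ i, c i • u i, z⟫) ^ 2 ∂(blG E) = σ ^ 2 * ‖∑ i, c i • u i‖ ^ 2 := by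
      simp only [mul_pow]
      rw [integral_const_mul, blG_inner_sq]
    have s3 : ∫ z, ∑ i, c i * (σ * ⟪u i, z⟫) ^ 2 ∂(blG E) = σ ^ 2 * ∑ i, c i * ‖u i‖ ^ 2 := by
      rw [integral_finsetSum _ fun i _ => i3 i, Finset.mul_sum]
      refine Finset.sum_congr rfl fun i _ => ?_
      simp only [mul_pow, integral_const_mul, blG_inner_sq]
      ring
    have hq := hA u fun i => by simp only [hu, map_smul, (H i).fix]
    have i5 : Integrable (fun z => ((σ * ⟪∑ i, c i • u i, z⟫) ^ 2
        - ∑ i, c i * (σ * ⟪u i, z⟫) ^ 2) / 2) (blG E) := (i2.sub i3').div_const 2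
    have i6 : Integrable (fun z => 1 + ∑ i, c i * Y i z + ((σ * ⟪∑ i, c i • u i, z⟫) ^ 2
        - ∑ i, c i * (σ * ⟪u i, z⟫) ^ 2) / 2) (blG E) := i1.add i5
    have s5 : ∫ z, (1 + ∑ i, c i * Y i z + ((σ * ⟪∑ i, c i • u i, z⟫) ^ 2
        - ∑ i, c i * (σ * ⟪u i, z⟫) ^ 2) / 2 + K * σ ^ 3 * (1 + ‖z‖) ^ 6) ∂(blG E) =
        1 + (σ ^ 2 * ‖∑ i, c i • u i‖ ^ 2 - σ ^ 2 * ∑ i, c i * ‖u i‖ ^ 2) / 2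
          + K * σ ^ 3 * ∫ z : E, (1 + ‖z‖) ^ 6 ∂(blG E) := by
      rw [integral_add i6 i4, integral_add i1 i5, integral_div, integral_sub i2 i3', s1, s2, s3,
        integral_const_mul]
    refine (le_of_eq s5).trans ?_
    nlinarith [mul_le_mul_of_nonneg_left hq (sq_nonneg σ)]


lemma blG_semigroup (α β ρ : ℝ) (h : α ^ 2 + β ^ 2 = ρ ^ 2) {f : E → ℝ} (hf : Measurable f)
    (D : ℝ) (hD : ∀ x, ‖f x‖ ≤ D) :
    ∫ z, ∫ z', f (α • z + β • z') ∂(blG E) ∂(blG E) = ∫ z, f (ρ • z) ∂(blG E) := by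
  have hP : ∀ r : ℝ, IsProbabilityMeasure ((blG E).map (r • ·)) := fun r =>
    Measure.isProbabilityMeasure_map (by fun_prop)
  have := hP α
  have := hP β
  have := hP ρ
  have key : ((blG E).map (α • ·)).conv ((blG E).map (β • ·)) = (blG E).map (ρ • ·) := by
    apply Measure.ext_of_charFun
    ext t
    rw [charFun_conv, charFun_map_smul, charFun_map_smul, charFun_map_smul, charFun_stdGaussian,
      charFun_stdGaussian, charFun_stdGaussian, ← Complex.exp_add]
    congr 1
    simp only [norm_smul, mul_pow, Real.norm_eq_abs, ← Complex.ofReal_pow]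
    norm_cast
    rw [← add_div]
    congr 1
    push_cast
    simp only [mul_pow, sq_abs]
    rw [← h]
    ring
  have e1 : ∫ z, f z ∂((blG E).map (ρ • ·)) = ∫ z, f (ρ • z) ∂(blG E) :=
    integral_map (by fun_prop) hf.aestronglyMeasurable
  rw [← e1, ← key, integral_conv (bl_bdd_integrable hf.aestronglyMeasurable D hD),
    integral_map (by fun_prop)]
  · refine integral_congr_ae (Eventually.of_forall fun z => ?_)
    show _ = ∫ y, f (α • z + y) ∂((blG E).map (β • ·))
    rw [integral_map (by fun_prop) (Measurable.aestronglyMeasurable (by fun_prop))]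
  · refine (StronglyMeasurable.integral_prod_right' (f := fun p : E × E => f (p.1 + p.2))
      ?_).aestronglyMeasurable
    exact Measurable.stronglyMeasurable (by fun_prop)

lemma BLReg.prod_meas {ι : Type*} [Fintype ι] {c : ι → ℝ} {A : ι → E →L[ℝ] E} {a b L : ℝ}
    {h : ι → E → ℝ} {G : ι → E → E} (H : ∀ i, BLReg a b L (A i) (h i) (G i)) :
    Measurable (fun x => ∏ i, h i x ^ c i) :=
  Finset.measurable_fun_prod _ fun i _ => ((H i).mh).pow_const _

lemma BLReg.prod_bdd {ι : Type*} [Fintype ι] {c : ι → ℝ} (hc : ∀ i, 0 < c i)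
    {A : ι → E →L[ℝ] E} {a b L : ℝ}
    (ha : 0 < a) {h : ι → E → ℝ} {G : ι → E → E} (H : ∀ i, BLReg a b L (A i) (h i) (G i)) (x : E) :
    ‖∏ i, h i x ^ c i‖ ≤ ∏ i, b ^ c i := by
  rw [norm_prod]
  refine Finset.prod_le_prod (fun i _ => norm_nonneg _) fun i _ => ?_
  have h0 := ha.trans_le ((H i).lo x)
  rw [Real.norm_eq_abs, abs_of_nonneg (Real.rpow_nonneg h0.le _)]
  exact Real.rpow_le_rpow h0.le ((H i).hi x) (hc i).le

lemma bl_iterate {ι : Type*} [Fintype ι] (c : ι → ℝ) (hc : ∀ i, 0 < c i)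
    (A : ι → E →L[ℝ] E) (a b L : ℝ) (ha : 0 < a) (K σ : ℝ) (hK : 0 ≤ K) (hσ : 0 ≤ σ)
    (hstep : ∀ (h : ι → E → ℝ) (G : ι → E → E),
      (∀ i, BLReg a b L (A i) (h i) (G i)) → ∀ x : E,
      ∫ z, ∏ i, h i (x + σ • z) ^ c i ∂(blG E) ≤ (1 + K * σ ^ 3) * ∏ i, blT σ (h i) x ^ c i)
    (k : ℕ) : ∀ (h : ι → E → ℝ) (G : ι → E → E),
      (∀ i, BLReg a b L (A i) (h i) (G i)) → ∀ x : E,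
      ∫ z, ∏ i, h i (x + (√k * σ) • z) ^ c i ∂(blG E)
        ≤ (1 + K * σ ^ 3) ^ k * ∏ i, blT (√k * σ) (h i) x ^ c i := by
  induction k with
  | zero => intro h G H x; simp [blT]
  | succ k ih =>
    intro h G H x
    have hsq : (√(k : ℝ) * σ) ^ 2 + σ ^ 2 = (√((k + 1 : ℕ) : ℝ) * σ) ^ 2 := by
      rw [mul_pow, mul_pow, Real.sq_sqrt (by positivity), Real.sq_sqrt (by positivity)]
      push_cast; ring
    have HT := fun i => (H i).avg ha σ
    have hsemi : ∀ i, blT (√(k : ℝ) * σ) (blT σ (h i)) x = blT (√((k + 1 : ℕ) : ℝ) * σ) (h i) x := by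
      intro i
      have mh := (H i).mh
      have := blG_semigroup _ _ _ hsq (f := fun y => h i (x + y)) (by fun_prop) b
        (fun y => (H i).abs_le ha _)
      simp only [blT]
      rw [← this]
      simp only [add_assoc]
    have mP : Measurable (fun y => ∏ i, h i (x + y) ^ c i) :=
      (BLReg.prod_meas H).comp (measurable_const_add x)
    have := blG_semigroup _ _ _ hsq mP _ (fun y => BLReg.prod_bdd hc ha H _)
    rw [← this]
    have hpos : 0 ≤ 1 + K * σ ^ 3 := by positivity
    have hnn : ∀ y, 0 ≤ ∏ i, h i y ^ c i := fun y => 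
      Finset.prod_nonneg fun i _ => Real.rpow_nonneg (ha.le.trans ((H i).lo y)) _
    have int2 : Integrable (fun z => ∏ i, blT σ (h i) (x + (√(k : ℝ) * σ) • z) ^ c i) (blG E) := by
      refine bl_bdd_integrable ?_ _ (fun z => BLReg.prod_bdd hc ha HT _)
      exact ((BLReg.prod_meas HT).comp (by fun_prop)).aestronglyMeasurable
    calc _ ≤ ∫ z, (1 + K * σ ^ 3) * ∏ i, blT σ (h i) (x + (√(k : ℝ) * σ) • z) ^ c i ∂(blG E) := by
          refine integral_mono_of_nonneg (Eventually.of_forall fun z => ?_) (int2.const_mul _)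
            (Eventually.of_forall fun z => ?_)
          · exact integral_nonneg fun z' => hnn _
          · have := hstep h G H (x + (√(k : ℝ) * σ) • z)
            simp only [add_assoc] at this ⊢
            exact this
      _ = (1 + K * σ ^ 3) * ∫ z, ∏ i, blT σ (h i) (x + (√(k : ℝ) * σ) • z) ^ c i ∂(blG E) :=
          integral_const_mul _ _
      _ ≤ (1 + K * σ ^ 3) * ((1 + K * σ ^ 3) ^ k *
          ∏ i, blT (√(k : ℝ) * σ) (blT σ (h i)) x ^ c i) := by
          gcongr
          exact ih _ _ HT x
      _ = _ := by simp only [hsemi]; ring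

lemma bl_reg {ι : Type*} [Fintype ι] (c : ι → ℝ) (hc : ∀ i, 0 < c i)
    (A : ι → E →L[ℝ] E)
    (hA : ∀ w : ι → E, (∀ i, A i (w i) = w i) → ‖∑ i, c i • w i‖ ^ 2 ≤ ∑ i, c i * ‖w i‖ ^ 2)
    (a b L : ℝ) (ha : 0 < a) (hab : a ≤ b) (hL : 0 ≤ L) (h : ι → E → ℝ) (G : ι → E → E)
    (H : ∀ i, BLReg a b L (A i) (h i) (G i)) :
    ∫ z, ∏ i, h i z ^ c i ∂(blG E) ≤ ∏ i, (∫ z, h i z ∂(blG E)) ^ c i := by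
  obtain ⟨K, hK, hstep⟩ := bl_one_step c hc A hA a b L ha hab hL
  set P := ∏ i, (∫ z, h i z ∂(blG E)) ^ c i with hP
  have hP0 : 0 ≤ P := Finset.prod_nonneg fun i _ => Real.rpow_nonneg
    (integral_nonneg fun z => ha.le.trans ((H i).lo z)) _
  have hbound : ∀ N : ℕ, ∫ z, ∏ i, h i z ^ c i ∂(blG E)
      ≤ Real.exp (K * (√((N : ℝ) + 1))⁻¹) * P := by
    intro N
    set s := √((N : ℝ) + 1) with hs
    have hs1 : 1 ≤ s := Real.one_le_sqrt.2 (by linarith [Nat.cast_nonneg (α := ℝ) N])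
    have hs0 : 0 < s := by linarith
    have hs2 : s ^ 2 = N + 1 := Real.sq_sqrt (by positivity)
    have hit := bl_iterate c hc A a b L ha K s⁻¹ hK (by positivity)
      (fun h G H x => hstep s⁻¹ h G (by positivity) (inv_le_one_of_one_le₀ hs1) H x) (N + 1) h G H 0
    have e : √((N + 1 : ℕ) : ℝ) * s⁻¹ = 1 := by
      push_cast; exact mul_inv_cancel₀ hs0.ne'
    rw [e] at hit
    simp only [blT, zero_add, one_smul] at hit
    refine hit.trans ?_
    refine mul_le_mul_of_nonneg_right ?_ hP0
    calc (1 + K * s⁻¹ ^ 3) ^ (N + 1) ≤ (Real.exp (K * s⁻¹ ^ 3)) ^ (N + 1) := by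
          gcongr
          rw [add_comm]
          exact Real.add_one_le_exp _
      _ = Real.exp ((N + 1 : ℕ) * (K * s⁻¹ ^ 3)) := (Real.exp_nat_mul _ _).symm
      _ = Real.exp (K * s⁻¹) := by
          congr 1
          push_cast
          rw [← hs2]
          field_simp
  have hlim : Tendsto (fun N : ℕ => Real.exp (K * (√((N : ℝ) + 1))⁻¹) * P) atTop (𝓝 P) := by
    have h1 : Tendsto (fun N : ℕ => (√((N : ℝ) + 1))⁻¹) atTop (𝓝 0) := by
      refine tendsto_inv_atTop_zero.comp (Real.tendsto_sqrt_atTop.comp ?_)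
      exact tendsto_atTop_add_const_right _ _ tendsto_natCast_atTop_atTop
    have h2 := ((Real.continuous_exp.tendsto _).comp (h1.const_mul K)).mul_const P
    simpa using h2
  exact ge_of_tendsto' hlim hbound

end core


section approx

open scoped ContDiff

lemma bl_approx {F : Type*} [NormedAddCommGroup F] [InnerProductSpace ℝ F] [FiniteDimensional ℝ F]
    [MeasurableSpace F] [BorelSpace F] (g : F → ℝ) (hg0 : ∀ x, 0 ≤ g x)
    (hg : Integrable g (blG F)) (ε : ℝ) (hε : 0 < ε) :
    ∃ ψ : F → ℝ, Differentiable ℝ ψ ∧ Continuous (fderiv ℝ ψ) ∧ (∃ a, 0 < a ∧ ∀ x, a ≤ ψ x) ∧ (∃ b, ∀ x, ψ x ≤ b) ∧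
      (∃ L, (∀ x, ‖fderiv ℝ ψ x‖ ≤ L) ∧
        ∀ x y, |ψ (x + y) - ψ x - fderiv ℝ ψ x y| ≤ L * ‖y‖ ^ 2) ∧
      Integrable ψ (blG F) ∧ ∫ x, |ψ x - g x| ∂(blG F) ≤ ε := by
  have hmem : MemLp g 1 (blG F) := memLp_one_iff_integrable.2 hg
  obtain ⟨φ₀, hφc, hφe, hφcont, hφm⟩ := hmem.exists_hasCompactSupport_eLpNorm_sub_le
    ENNReal.one_ne_top (ε := ENNReal.ofReal (ε / 4)) (by simp [hε])
  have hφi : Integrable φ₀ (blG F) := memLp_one_iff_integrable.1 hφm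
  have hφe' : ∫ x, |g x - φ₀ x| ∂(blG F) ≤ ε / 4 := by
    rw [eLpNorm_one_eq_lintegral_enorm] at hφe
    have := integral_norm_eq_lintegral_enorm (hg.sub hφi).aestronglyMeasurable
    simp only [Pi.sub_apply, Real.norm_eq_abs] at this
    rw [this]
    exact ENNReal.toReal_le_of_le_ofReal (by positivity) hφe
  have hcont1 : Continuous (fun x => max (φ₀ x) 0) := by fun_prop
  have hcs1 : HasCompactSupport (fun x => max (φ₀ x) 0) :=
    hφc.comp_left (g := fun t => max t 0) (by simp)
  obtain ⟨φ, hφsm, hφd, hφsupp⟩ := hcont1.exists_contDiff_approx ⊤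
    (ε := fun _ => ε / 4) continuous_const (fun _ => by positivity)
  have hcs : HasCompactSupport φ := hcs1.mono hφsupp
  have hfd : fderiv ℝ (fun x => φ x + ε / 2) = fderiv ℝ φ := by
    ext1 x; rw [fderiv_add_const]
  have hd : Differentiable ℝ φ := hφsm.differentiable (by simp)
  have hd1 : ContDiff ℝ 1 (fderiv ℝ φ) := hφsm.fderiv_right (by norm_cast)
  obtain ⟨C, hC⟩ := hd1.lipschitzWith_of_hasCompactSupport (hcs.fderiv ℝ) (by simp)
  obtain ⟨D, hD⟩ := (hcs.fderiv ℝ).exists_bound_of_continuous hd1.continuous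
  obtain ⟨b, hb⟩ := hcs.exists_bound_of_continuous hφsm.continuous
  have habs : ∀ x, |φ x - max (φ₀ x) 0| ≤ ε / 4 := fun x => by
    have := (hφd x).le
    rwa [Real.dist_eq] at this
  have hφint : Integrable (fun x => φ x + ε / 2) (blG F) :=
    (bl_bdd_integrable hφsm.continuous.aestronglyMeasurable b hb).add (integrable_const _)
  refine ⟨fun x => φ x + ε / 2, hd.add_const _, ?_, ⟨ε / 4, by positivity, fun x => ?_⟩,
    ⟨b + ε / 2, fun x => ?_⟩, ⟨max D C, fun x => ?_, fun x y => ?_⟩, hφint, ?_⟩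
  · rw [hfd]; exact hd1.continuous
  · have := (abs_le.1 (habs x)).1
    have := le_max_right (φ₀ x) 0
    linarith
  · have := hb x
    rw [Real.norm_eq_abs] at this
    linarith [le_abs_self (φ x)]
  · rw [hfd]; exact (hD x).trans (le_max_left _ _)
  · rw [hfd]
    have := (convex_closedBall x ‖y‖).norm_image_sub_le_of_norm_fderiv_le' (𝕜 := ℝ) (f := φ)
      (φ := fderiv ℝ φ x) (C := C * ‖y‖) (x := x) (y := x + y) (fun z _ => hd z) (fun z hz => by
        have h1 := hC.dist_le_mul z x
        rw [dist_eq_norm] at h1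
        refine h1.trans ?_
        gcongr
        exact hz) (by simp) (by simp)
    rw [add_sub_cancel_left, Real.norm_eq_abs] at this
    have e : φ (x + y) + ε / 2 - (φ x + ε / 2) - fderiv ℝ φ x y
      = φ (x + y) - φ x - fderiv ℝ φ x y := by ring
    rw [e]
    refine this.trans ?_
    rw [mul_assoc, ← sq]
    gcongr
    exact le_max_right _ _
  · have hle : ∀ x, |φ x + ε / 2 - g x| ≤ |g x - φ₀ x| + 3 * ε / 4 := by
      intro x
      have h1 := abs_le.1 (habs x)
      have h2 : |max (φ₀ x) 0 - g x| ≤ |g x - φ₀ x| := by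
        have := abs_max_sub_max_le_abs (φ₀ x) (g x) 0
        rwa [max_eq_left (hg0 x), abs_sub_comm (φ₀ x)] at this
      have h3 := abs_le.1 h2
      rw [abs_le]
      constructor <;> linarith
    have hi : Integrable (fun x => |g x - φ₀ x|) (blG F) := (hg.sub hφi).abs
    calc _ ≤ ∫ x, (|g x - φ₀ x| + 3 * ε / 4) ∂(blG F) :=
          integral_mono (hφint.sub hg).abs (hi.add (integrable_const _)) hle
      _ = ∫ x, |g x - φ₀ x| ∂(blG F) + 3 * ε / 4 := by
          rw [integral_add hi (integrable_const _)]; simp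
      _ ≤ ε := by linarith

end approx


section final

variable {E : Type*} [NormedAddCommGroup E] [InnerProductSpace ℝ E] [FiniteDimensional ℝ E]
  [MeasurableSpace E] [BorelSpace E]

lemma bl_map {F : Type*} [NormedAddCommGroup F] [InnerProductSpace ℝ F] [FiniteDimensional ℝ F]
    [MeasurableSpace F] [BorelSpace F] (U : E →L[ℝ] F) (V : F →L[ℝ] E)
    (hadj : ∀ x y, ⟪V y, x⟫ = ⟪y, U x⟫) (hUV : ∀ y, U (V y) = y) :
    (blG E).map U = blG F := by
  have : IsProbabilityMeasure ((blG E).map U) := Measure.isProbabilityMeasure_map (by fun_prop)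
  apply Measure.ext_of_charFun
  ext t
  have h1 : charFun ((blG E).map U) t = charFun (blG E) (V t) := by
    rw [charFun_apply, charFun_apply, integral_map (by fun_prop) (by fun_prop)]
    refine integral_congr_ae (Eventually.of_forall fun x => ?_)
    simp only
    rw [real_inner_comm, ← hadj, real_inner_comm]
  have h2 : ‖V t‖ ^ 2 = ‖t‖ ^ 2 := by
    rw [← real_inner_self_eq_norm_sq, ← real_inner_self_eq_norm_sq, hadj, hUV]
  rw [h1, charFun_stdGaussian, charFun_stdGaussian]
  norm_cast
  rw [h2]

variable {ι : Type*} [Fintype ι] {F : ι → Type*} [∀ i, NormedAddCommGroup (F i)]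
  [∀ i, InnerProductSpace ℝ (F i)] [∀ i, FiniteDimensional ℝ (F i)]
  [∀ i, MeasurableSpace (F i)] [∀ i, BorelSpace (F i)]

lemma bl_quad (c : ι → ℝ) (hc : ∀ i, 0 < c i) (U : ∀ i, E →L[ℝ] F i) (V : ∀ i, F i →L[ℝ] E)
    (hadj : ∀ i x y, ⟪V i y, x⟫ = ⟪y, U i x⟫)
    (hdec : ∀ x, ∑ i, c i • V i (U i x) = x) (w : ι → E)
    (hw : ∀ i, (V i ∘L U i) (w i) = w i) :
    ‖∑ i, c i • w i‖ ^ 2 ≤ ∑ i, c i * ‖w i‖ ^ 2 := by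
  set s := ∑ i, c i • w i with hs
  have h1 : ‖s‖ ^ 2 = ∑ i, c i * ⟪U i (w i), U i s⟫ := by
    rw [← real_inner_self_eq_norm_sq]
    nth_rewrite 1 [hs]
    rw [sum_inner]
    refine Finset.sum_congr rfl fun i _ => ?_
    rw [real_inner_smul_left, ← hadj]
    have := hw i
    simp only [ContinuousLinearMap.comp_apply] at this
    rw [this]
  have h2 : ‖s‖ ^ 2 = ∑ i, c i * ‖U i s‖ ^ 2 := by
    rw [← real_inner_self_eq_norm_sq]
    nth_rewrite 1 [← hdec s]
    rw [sum_inner]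
    refine Finset.sum_congr rfl fun i _ => ?_
    rw [real_inner_smul_left, hadj, real_inner_self_eq_norm_sq]
  have h3 : ∀ i, ‖U i (w i)‖ ^ 2 = ‖w i‖ ^ 2 := fun i => by
    rw [← real_inner_self_eq_norm_sq, ← hadj, ← real_inner_self_eq_norm_sq]
    have := hw i
    simp only [ContinuousLinearMap.comp_apply] at this
    rw [this]
  have h4 : ∑ i, c i * ⟪U i (w i), U i s⟫ ≤ ∑ i, (c i * ‖w i‖ ^ 2 + c i * ‖U i s‖ ^ 2) / 2 := by
    refine Finset.sum_le_sum fun i _ => ?_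
    have := real_inner_le_norm (U i (w i)) (U i s)
    rw [← h3]
    have h5 : ⟪U i (w i), U i s⟫ ≤ (‖U i (w i)‖ ^ 2 + ‖U i s‖ ^ 2) / 2 := by
      nlinarith [sq_nonneg (‖U i (w i)‖ - ‖U i s‖)]
    have := mul_le_mul_of_nonneg_left h5 (hc i).le
    linarith
  rw [← Finset.sum_div, Finset.sum_add_distrib, ← h2] at h4
  linarith

lemma bl_smooth (c : ι → ℝ) (hc : ∀ i, 0 < c i) (U : ∀ i, E →L[ℝ] F i) (V : ∀ i, F i →L[ℝ] E)
    (hadj : ∀ i x y, ⟪V i y, x⟫ = ⟪y, U i x⟫) (hUV : ∀ i y, U i (V i y) = y)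
    (hdec : ∀ x, ∑ i, c i • V i (U i x) = x) (ψ : ∀ i, F i → ℝ)
    (hd : ∀ i, Differentiable ℝ (ψ i)) (hcd : ∀ i, Continuous (fderiv ℝ (ψ i)))
    (hlo : ∀ i, ∃ a, 0 < a ∧ ∀ x, a ≤ ψ i x) (hhi : ∀ i, ∃ b, ∀ x, ψ i x ≤ b)
    (hL : ∀ i, ∃ L, (∀ x, ‖fderiv ℝ (ψ i) x‖ ≤ L) ∧
        ∀ x y, |ψ i (x + y) - ψ i x - fderiv ℝ (ψ i) x y| ≤ L * ‖y‖ ^ 2) :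
    ∫ x, ∏ i, ψ i (U i x) ^ c i ∂(blG E) ≤ ∏ i, (∫ y, ψ i y ∂(blG (F i))) ^ c i := by
  choose a ha0 ha using hlo
  choose b hb using hhi
  choose L hL1 hL2 using hL
  have hL0 : ∀ i, 0 ≤ L i := fun i => (norm_nonneg _).trans (hL1 i 0)
  obtain ⟨a', ha'0, ha'⟩ : ∃ a', 0 < a' ∧ ∀ i, a' ≤ a i := by
    obtain ⟨M, hM⟩ := Finite.exists_le (fun i => (a i)⁻¹)
    refine ⟨(max M 1)⁻¹, by positivity, fun i => ?_⟩
    rw [inv_le_comm₀ (by positivity) (ha0 i)]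
    exact (hM i).trans (le_max_left _ _)
  obtain ⟨b', hb'⟩ := Finite.exists_le b
  obtain ⟨L', hL'⟩ := Finite.exists_le (fun i => L i * (‖U i‖ ^ 2 + ‖V i‖))
  set G : ∀ i, E → E := fun i x => V i ((InnerProductSpace.toDual ℝ (F i)).symm
    (fderiv ℝ (ψ i) (U i x))) with hG
  have hreg : ∀ i, BLReg a' (max a' b') (max 0 L') (V i ∘L U i) (fun x => ψ i (U i x)) (G i) := by
    intro i
    have hUn : 0 ≤ ‖U i‖ ^ 2 := by positivity
    have hVn : 0 ≤ ‖V i‖ := norm_nonneg _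
    have hLi := hL0 i
    have hLi' := hL' i
    refine ⟨?_, ?_, fun x => (ha' i).trans (ha i _), fun x => ((hb i _).trans (hb' i)).trans
      (le_max_right _ _), fun x => ?_, fun x => ?_, fun x y => ?_⟩
    · exact ((hd i).continuous.comp (U i).continuous).measurable
    · refine Continuous.measurable ?_
      exact (V i).continuous.comp ((LinearIsometryEquiv.continuous _).comp
        ((hcd i).comp (U i).continuous))
    · refine le_trans ?_ (le_max_right _ _)
      refine ((V i).le_opNorm _).trans ?_
      rw [LinearIsometryEquiv.norm_map]
      have := mul_le_mul_of_nonneg_left (hL1 i (U i x)) hVn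
      nlinarith [mul_nonneg hLi hUn]
    · simp only [hG, ContinuousLinearMap.comp_apply, hUV]
    · have h1 := hL2 i (U i x) (U i y)
      have h2 : ⟪G i x, y⟫ = fderiv ℝ (ψ i) (U i x) (U i y) := by
        simp only [hG]
        rw [hadj, InnerProductSpace.toDual_symm_apply]
      rw [h2]
      simp only [map_add]
      refine h1.trans ?_
      have h3 := (U i).le_opNorm y
      calc L i * ‖U i y‖ ^ 2 ≤ L i * (‖U i‖ * ‖y‖) ^ 2 := by gcongr
        _ = L i * ‖U i‖ ^ 2 * ‖y‖ ^ 2 := by ring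
        _ ≤ max 0 L' * ‖y‖ ^ 2 := by
          gcongr
          refine le_trans ?_ (le_max_right _ _)
          nlinarith [mul_nonneg hLi hVn]
  have key := bl_reg c hc (fun i => V i ∘L U i) (bl_quad c hc U V hadj hdec) a' (max a' b')
    (max 0 L') ha'0 (le_max_left _ _) (le_max_left _ _) _ G hreg
  refine key.trans (le_of_eq ?_)
  refine Finset.prod_congr rfl fun i _ => ?_
  rw [← bl_map (U i) (V i) (hadj i) (hUV i), integral_map (by fun_prop)
    (hd i).continuous.aestronglyMeasurable]

lemma bl_L1 (c : ι → ℝ) (hc : ∀ i, 0 < c i) (U : ∀ i, E →L[ℝ] F i) (V : ∀ i, F i →L[ℝ] E)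
    (hadj : ∀ i x y, ⟪V i y, x⟫ = ⟪y, U i x⟫) (hUV : ∀ i y, U i (V i y) = y)
    (hdec : ∀ x, ∑ i, c i • V i (U i x) = x) (g : ∀ i, F i → ℝ)
    (hg0 : ∀ i x, 0 ≤ g i x) (hgm : ∀ i, Measurable (g i))
    (hgi : ∀ i, Integrable (g i) (blG (F i))) :
    ∫⁻ x, ∏ i, ENNReal.ofReal (g i (U i x)) ^ c i ∂(blG E)
      ≤ ∏ i, ENNReal.ofReal (∫ y, g i y ∂(blG (F i))) ^ c i := by
  choose ψ hd hcd hlo hhi hL hψi hψe using fun (j : ℕ) (i : ι) =>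
    bl_approx (g i) (hg0 i) (hgi i) (1 / ((j : ℝ) + 1)) (by positivity)
  have hψ0 : ∀ j i x, 0 ≤ ψ j i x := fun j i x => by
    obtain ⟨a, ha, h⟩ := hlo j i
    exact ha.le.trans (h x)
  have hlim0 : Tendsto (fun j : ℕ => 1 / ((j : ℝ) + 1)) atTop (𝓝 0) :=
    tendsto_one_div_add_atTop_nhds_zero_nat
  -- the integrals converge
  have hint : ∀ i, Tendsto (fun j => ∫ y, ψ j i y ∂(blG (F i))) atTop
      (𝓝 (∫ y, g i y ∂(blG (F i)))) := by
    intro i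
    rw [tendsto_iff_dist_tendsto_zero]
    refine squeeze_zero (fun _ => dist_nonneg) (fun j => ?_) hlim0
    rw [Real.dist_eq, ← integral_sub (hψi j i) (hgi i)]
    exact (abs_integral_le_integral_abs).trans (hψe j i)
  -- a subsequence converges almost everywhere
  have mp : ∀ i, MeasurePreserving (U i) (blG E) (blG (F i)) := fun i =>
    ⟨by fun_prop, bl_map (U i) (V i) (hadj i) (hUV i)⟩
  set D : ℕ → E → ℝ := fun j x => ∑ i, |ψ j i (U i x) - g i (U i x)| with hD
  have hDi : ∀ j i, Integrable (fun x => |ψ j i (U i x) - g i (U i x)|) (blG E) := fun j i =>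
    (mp i).integrable_comp_of_integrable ((hψi j i).sub (hgi i)).abs
  have hDint : ∀ j, Integrable (D j) (blG E) := fun j => integrable_finsetSum _ fun i _ => hDi j i
  have hDle : ∀ j, ∫ x, D j x ∂(blG E) ≤ Fintype.card ι * (1 / ((j : ℝ) + 1)) := by
    intro j
    simp only [hD]
    rw [integral_finsetSum _ fun i _ => hDi j i]
    calc _ ≤ ∑ i : ι, (1 / ((j : ℝ) + 1)) := by
          refine Finset.sum_le_sum fun i _ => ?_
          refine le_trans (le_of_eq ?_) (hψe j i)
          have h1 : AEStronglyMeasurable (fun y => |ψ j i y - g i y|) ((blG E).map (U i)) := by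
            rw [(mp i).map_eq]
            exact ((hψi j i).sub (hgi i)).abs.aestronglyMeasurable
          have := integral_map (mp i).aemeasurable h1
          rw [(mp i).map_eq] at this
          exact this.symm
      _ = _ := by simp
  have hD0 : ∀ j x, 0 ≤ D j x := fun j x => Finset.sum_nonneg fun i _ => abs_nonneg _
  have hDm : TendstoInMeasure (blG E) D atTop (fun _ => (0 : ℝ)) := by
    refine tendstoInMeasure_of_tendsto_eLpNorm (p := 1) one_ne_zero
      (fun j => (hDint j).aestronglyMeasurable) aestronglyMeasurable_const ?_
    have e : ∀ j, eLpNorm (D j - fun _ => (0 : ℝ)) 1 (blG E)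
        = ENNReal.ofReal (∫ x, D j x ∂(blG E)) := fun j => by
      rw [eLpNorm_one_eq_lintegral_enorm, ofReal_integral_eq_lintegral_ofReal (hDint j)
        (Eventually.of_forall (hD0 j))]
      refine lintegral_congr fun x => ?_
      simp only [Pi.sub_apply, sub_zero]
      exact Real.enorm_of_nonneg (hD0 j x)
    simp only [e]
    rw [← ENNReal.ofReal_zero]
    refine ENNReal.tendsto_ofReal ?_
    refine squeeze_zero (fun j => integral_nonneg (hD0 j)) hDle ?_
    simpa using hlim0.const_mul (Fintype.card ι : ℝ)
  obtain ⟨ns, hns, hae⟩ := hDm.exists_seq_tendsto_ae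
  have hae' : ∀ᵐ x ∂(blG E), ∏ i, ENNReal.ofReal (g i (U i x)) ^ c i
      = liminf (fun k => ∏ i, ENNReal.ofReal (ψ (ns k) i (U i x)) ^ c i) atTop := by
    filter_upwards [hae] with x hx
    refine (Tendsto.liminf_eq ?_).symm
    refine ENNReal.tendsto_finsetProd_of_ne_top _ (fun i _ => ?_) (fun i _ => ?_)
    · refine (ENNReal.continuous_rpow_const.tendsto _).comp (ENNReal.tendsto_ofReal ?_)
      rw [tendsto_iff_dist_tendsto_zero]
      refine squeeze_zero (fun _ => dist_nonneg) (fun k => ?_) hx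
      rw [Real.dist_eq]
      exact Finset.single_le_sum (f := fun i => |ψ (ns k) i (U i x) - g i (U i x)|)
        (fun i _ => abs_nonneg _) (Finset.mem_univ i)
    · exact ENNReal.rpow_ne_top_of_nonneg (hc i).le ENNReal.ofReal_ne_top
  have hmeas : ∀ k, Measurable (fun x => ∏ i, ENNReal.ofReal (ψ k i (U i x)) ^ c i) := fun k => by
    refine Finset.measurable_fun_prod _ fun i _ => ?_
    exact (((hd k i).continuous.comp (U i).continuous).measurable.ennreal_ofReal).pow_const _
  have hstep : ∀ k, ∫⁻ x, ∏ i, ENNReal.ofReal (ψ k i (U i x)) ^ c i ∂(blG E)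
      ≤ ∏ i, ENNReal.ofReal (∫ y, ψ k i y ∂(blG (F i))) ^ c i := by
    intro k
    have key := bl_smooth c hc U V hadj hUV hdec (ψ k) (hd k) (hcd k) (hlo k) (hhi k) (hL k)
    have e1 : ∀ x, ∏ i, ENNReal.ofReal (ψ k i (U i x)) ^ c i
        = ENNReal.ofReal (∏ i, ψ k i (U i x) ^ c i) := fun x => by
      rw [ENNReal.ofReal_prod_of_nonneg fun i _ => Real.rpow_nonneg (hψ0 k i _) _]
      exact Finset.prod_congr rfl fun i _ => ENNReal.ofReal_rpow_of_nonneg (hψ0 k i _) (hc i).le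
    have e2 : ∏ i, ENNReal.ofReal (∫ y, ψ k i y ∂(blG (F i))) ^ c i
        = ENNReal.ofReal (∏ i, (∫ y, ψ k i y ∂(blG (F i))) ^ c i) := by
      have h0 : ∀ i, 0 ≤ ∫ y, ψ k i y ∂(blG (F i)) := fun i => integral_nonneg (hψ0 k i)
      rw [ENNReal.ofReal_prod_of_nonneg fun i _ => Real.rpow_nonneg (h0 i) _]
      exact Finset.prod_congr rfl fun i _ => ENNReal.ofReal_rpow_of_nonneg (h0 i) (hc i).le
    simp only [e1]
    rw [e2, ← ofReal_integral_eq_lintegral_ofReal]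
    · exact ENNReal.ofReal_le_ofReal key
    · choose b hb using hhi k
      refine bl_bdd_integrable ?_ (∏ i, b i ^ c i) fun x => ?_
      · refine Measurable.aestronglyMeasurable (Finset.measurable_fun_prod _ fun i _ => ?_)
        exact ((hd k i).continuous.comp (U i).continuous).measurable.pow_const _
      · rw [norm_prod]
        refine Finset.prod_le_prod (fun i _ => norm_nonneg _) fun i _ => ?_
        rw [Real.norm_eq_abs, abs_of_nonneg (Real.rpow_nonneg (hψ0 k i _) _)]
        exact Real.rpow_le_rpow (hψ0 k i _) (hb i _) (hc i).le
    · exact Eventually.of_forall fun x => Finset.prod_nonneg fun i _ =>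
        Real.rpow_nonneg (hψ0 k i _) _
  have hR : Tendsto (fun k => ∏ i, ENNReal.ofReal (∫ y, ψ (ns k) i y ∂(blG (F i))) ^ c i) atTop
      (𝓝 (∏ i, ENNReal.ofReal (∫ y, g i y ∂(blG (F i))) ^ c i)) := by
    refine ENNReal.tendsto_finsetProd_of_ne_top _ (fun i _ => ?_) (fun i _ => ?_)
    · exact (ENNReal.continuous_rpow_const.tendsto _).comp (ENNReal.tendsto_ofReal
        ((hint i).comp hns.tendsto_atTop))
    · exact ENNReal.rpow_ne_top_of_nonneg (hc i).le ENNReal.ofReal_ne_top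
  calc _ = ∫⁻ x, liminf (fun k => ∏ i, ENNReal.ofReal (ψ (ns k) i (U i x)) ^ c i) atTop ∂(blG E) :=
        lintegral_congr_ae hae'
    _ ≤ liminf (fun k => ∫⁻ x, ∏ i, ENNReal.ofReal (ψ (ns k) i (U i x)) ^ c i ∂(blG E)) atTop :=
        lintegral_liminf_le fun k => hmeas _
    _ ≤ liminf (fun k => ∏ i, ENNReal.ofReal (∫ y, ψ (ns k) i y ∂(blG (F i))) ^ c i) atTop :=
        liminf_le_liminf (Eventually.of_forall fun k => hstep _)
    _ = _ := hR.liminf_eq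

lemma bl_gen (c : ι → ℝ) (hc : ∀ i, 0 < c i) (U : ∀ i, E →L[ℝ] F i) (V : ∀ i, F i →L[ℝ] E)
    (hadj : ∀ i x y, ⟪V i y, x⟫ = ⟪y, U i x⟫) (hUV : ∀ i y, U i (V i y) = y)
    (hdec : ∀ x, ∑ i, c i • V i (U i x) = x) (g : ∀ i, F i → ℝ)
    (hg0 : ∀ i x, 0 ≤ g i x) (hgm : ∀ i, Measurable (g i)) :
    ∫⁻ x, ∏ i, ENNReal.ofReal (g i (U i x)) ^ c i ∂(blG E)
      ≤ ∏ i, (∫⁻ y, ENNReal.ofReal (g i y) ∂(blG (F i))) ^ c i := by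
  by_cases hz : ∃ i, ∫⁻ y, ENNReal.ofReal (g i y) ∂(blG (F i)) = 0
  · obtain ⟨i, hi⟩ := hz
    rw [lintegral_eq_zero_iff (hgm i).ennreal_ofReal] at hi
    have mp : MeasurePreserving (U i) (blG E) (blG (F i)) :=
      ⟨by fun_prop, bl_map (U i) (V i) (hadj i) (hUV i)⟩
    have h1 := mp.quasiMeasurePreserving.ae hi
    have : ∫⁻ x, ∏ i, ENNReal.ofReal (g i (U i x)) ^ c i ∂(blG E) = ∫⁻ x, 0 ∂(blG E) := by
      refine lintegral_congr_ae ?_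
      filter_upwards [h1] with x hx
      refine Finset.prod_eq_zero (Finset.mem_univ i) ?_
      rw [hx]
      simp [hc i]
    rw [this]
    simp
  · push Not at hz
    by_cases ht : ∃ i, ∫⁻ y, ENNReal.ofReal (g i y) ∂(blG (F i)) = ∞
    · obtain ⟨i, hi⟩ := ht
      have : ∏ i, (∫⁻ y, ENNReal.ofReal (g i y) ∂(blG (F i))) ^ c i = ∞ := by
        refine WithTop.prod_eq_top (Finset.mem_univ i) ?_ ?_
        · rw [hi]; exact ENNReal.top_rpow_of_pos (hc i)
        · intro j _
          have hj : (∫⁻ y, ENNReal.ofReal (g j y) ∂(blG (F j))) ^ c j ≠ 0 := by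
            intro h0
            rcases ENNReal.rpow_eq_zero_iff.1 h0 with h | h
            · exact hz j h.1
            · exact absurd h.2 (not_lt.2 (hc j).le)
          exact hj
      rw [this]
      exact le_top
    · push Not at ht
      have hgi : ∀ i, Integrable (g i) (blG (F i)) := fun i => by
        refine ⟨(hgm i).aestronglyMeasurable, ?_⟩
        rw [hasFiniteIntegral_iff_ofReal (Eventually.of_forall (hg0 i))]
        exact (ht i).lt_top
      have := bl_L1 c hc U V hadj hUV hdec g hg0 hgm hgi
      refine this.trans (le_of_eq ?_)
      refine Finset.prod_congr rfl fun i _ => ?_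
      rw [ofReal_integral_eq_lintegral_ofReal (hgi i) (Eventually.of_forall (hg0 i))]

end final

end BL


/-- The continuous linear map between Euclidean spaces given by a matrix. -/
noncomputable def blMat {a b : ℕ} (A : Matrix (Fin a) (Fin b) ℝ) :
    EuclideanSpace ℝ (Fin b) →L[ℝ] EuclideanSpace ℝ (Fin a) :=
  LinearMap.toContinuousLinearMap (Matrix.toEuclideanLin A)

lemma blMat_apply {a b : ℕ} (A : Matrix (Fin a) (Fin b) ℝ) (x : EuclideanSpace ℝ (Fin b)) :
    blMat A x = WithLp.toLp 2 (A.mulVec (WithLp.ofLp x)) := rfl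

lemma bl_lintegral {a : ℕ} (h : (Fin a → ℝ) → ℝ≥0∞) (hh : Measurable h) :
    ∫⁻ x, h x ∂(_root_.stdGaussian (Fin a))
      = ∫⁻ y, h (WithLp.ofLp y) ∂(blG (EuclideanSpace ℝ (Fin a))) := by
  have hm : Measurable (fun y : EuclideanSpace ℝ (Fin a) => h (WithLp.ofLp y)) :=
    hh.comp (by fun_prop)
  rw [blG, ← ProbabilityTheory.map_pi_eq_stdGaussian, lintegral_map hm (by fun_prop)]
  rfl

/-- **Geometric Brascamp-Lieb inequality for Gaussian measures**: if
`UᵢUᵢᵀ = I` and `∑ pᵢ⁻¹ Uᵢᵀ Uᵢ = Iₙ` (i.e. `UᵀP⁻¹U = Iₙ`), then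
`∫ ∏ fᵢ(Uᵢ x) dγₙ ≤ ∏ ‖fᵢ‖_{L_{pᵢ}(γ_{nᵢ})}`. -/
theorem stmt6
    (m n : ℕ) (hmn : n ≤ m) (hn : 0 < n)
    (nn : Fin m → ℕ) (hnn : ∀ i, 0 < nn i) (hnnle : ∀ i, nn i ≤ n)
    (p : Fin m → ℝ) (hp : ∀ i, 0 < p i)
    (U : ∀ i, Matrix (Fin (nn i)) (Fin n) ℝ)
    (hU : ∀ i, U i * (U i)ᵀ = 1)
    (hdecomp : ∑ i, (p i)⁻¹ • ((U i)ᵀ * U i) = 1)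
    (f : ∀ i, (Fin (nn i) → ℝ) → ℝ)
    (hmeas : ∀ i, Measurable (f i)) (hpos : ∀ i x, 0 ≤ f i x) :
    ∫⁻ x, ∏ i, ENNReal.ofReal (f i ((U i).mulVec x)) ∂(stdGaussian (Fin n))
      ≤ ∏ i, (∫⁻ z, ENNReal.ofReal (f i z) ^ (p i)
          ∂(stdGaussian (Fin (nn i)))) ^ (1 / p i) := by
  have hfm : ∀ i, Measurable fun z => ENNReal.ofReal (f i z) := fun i =>
    (hmeas i).ennreal_ofReal
  have key := bl_gen (E := EuclideanSpace ℝ (Fin n))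
    (F := fun i => EuclideanSpace ℝ (Fin (nn i)))
    (c := fun i => (p i)⁻¹) (fun i => inv_pos.2 (hp i))
    (fun i => blMat (U i)) (fun i => blMat (U i)ᵀ)
    (by
      intro i x y
      simp only [blMat_apply, EuclideanSpace.inner_eq_star_dotProduct, star_trivial]
      rw [Matrix.dotProduct_mulVec, Matrix.vecMul_transpose, dotProduct_comm])
    (by
      intro i y
      simp only [blMat_apply, Matrix.mulVec_mulVec, hU i, Matrix.one_mulVec])
    (by
      intro x
      have h1 := congrArg (fun M => M.mulVec (WithLp.ofLp x)) hdecomp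
      simp only [Matrix.sum_mulVec, Matrix.smul_mulVec, Matrix.one_mulVec] at h1
      simp only [blMat_apply, Matrix.mulVec_mulVec]
      apply WithLp.ofLp_injective 2
      simpa [WithLp.ofLp_sum] using h1)
    (g := fun i y => f i (WithLp.ofLp y) ^ p i)
    (fun i y => Real.rpow_nonneg (hpos i _) _)
    (fun i => ((hmeas i).comp (by fun_prop)).pow_const _)
  have hprod : Measurable fun x : Fin n → ℝ =>
      ∏ i, ENNReal.ofReal (f i ((U i).mulVec x)) := by
    refine Finset.measurable_prod _ fun i _ => (hfm i).comp ?_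
    exact (Continuous.matrix_mulVec continuous_const continuous_id).measurable
  rw [bl_lintegral _ hprod]
  have e1 : ∀ i z, ENNReal.ofReal (f i z ^ p i) = ENNReal.ofReal (f i z) ^ p i := fun i z =>
    (ENNReal.ofReal_rpow_of_nonneg (hpos i z) (hp i).le).symm
  simp only [e1, blMat_apply, ENNReal.rpow_rpow_inv (hp _).ne'] at key
  refine key.trans (le_of_eq ?_)
  refine Finset.prod_congr rfl fun i _ => ?_
  rw [bl_lintegral _ ((hfm i).pow_const _), one_div]
end
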